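/- Let n ≥ 3, let k ≥ 1 be an integer, and let a > 0 be such that for all s ∈ (0,1] and all 1 ≤ i ≤ k one has a − ln X_i(a,s) > 0 (so that X_1(a,s), …, X_{k+1}(a,s) are well defined and positive on (0,1]). Assume moreover that X_1(a,1) · X_2(a,1) ⋯ X_{k+1}(a,1) ≤ n−2. Then for every u ∈ C_c^∞(B_1), ∫_{B_1} |∇u|² dx ≥ ((n-2)/2)² ∫_{B_1} u²/|x|² dx + (1/4) Σ_{i=1}^{k} ∫_{B_1} (X_1(a,|x|)² ⋯ X_i(a,|x|)²)/|x|² · u² dx + (n-2)^{-2(n-1)/n} S_n · ( ∫_{B_1} ( X_1(a,|x|) ⋯ X_{k+1}(a,|x|) )^{2(n-1)/(n-2)} |u|^{2n/(n-2)} dx )^{(n-2)/n}. -/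

import Mathlib

open MeasureTheory Real

/-- The best Sobolev constant `S_n = π n (n-2) (Γ(n/2)/Γ(n))^(2/n)`. -/
noncomputable def sobolevConst (n : ℕ) : ℝ :=
  Real.pi * n * ((n : ℝ) - 2) * (Real.Gamma ((n : ℝ) / 2) / Real.Gamma (n : ℝ)) ^ (2 / (n : ℝ))

/-- `X_1(a,s) = (a - ln s)⁻¹`. -/
noncomputable def X1 (a s : ℝ) : ℝ := (a - Real.log s)⁻¹

/-- Iterated logarithm functions: `Xiter a i s` is `X_i(a,s)`, with `X_0(a,s) = s`. -/
noncomputable def Xiter (a : ℝ) : ℕ → ℝ → ℝ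
  | 0, s => s
  | (i + 1), s => X1 a (Xiter a i s)

/-- The symmetric cube `[-b, b]^m`. -/
def symBox (m : ℕ) (b : ℝ) : Set (Fin m → ℝ) := Set.Icc (fun _ => -b) (fun _ => b)

lemma isCompact_symBox (m : ℕ) (b : ℝ) : IsCompact (symBox m b) := isCompact_Icc

lemma measurableSet_symBox (m : ℕ) (b : ℝ) : MeasurableSet (symBox m b) := measurableSet_Icc

lemma mem_symBox {m : ℕ} {b : ℝ} {x : Fin m → ℝ} : x ∈ symBox m b ↔ ∀ i, |x i| ≤ b := by
  simp only [symBox, Set.mem_Icc, Pi.le_def, abs_le, forall_and]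

lemma continuous_fin_cons (m : ℕ) :
    Continuous (fun p : ℝ × (Fin m → ℝ) => (Fin.cons p.1 p.2 : Fin (m + 1) → ℝ)) := by
  fun_prop

lemma continuous_integral_symBox {m : ℕ} {b : ℝ} {X : Type*} [TopologicalSpace X]
    [FirstCountableTopology X] [LocallyCompactSpace X]
    {F : X → (Fin m → ℝ) → ℝ} (hF : Continuous (Function.uncurry F)) :
    Continuous (fun x => ∫ y in symBox m b, F x y) :=
  continuous_parametric_integral_of_continuous hF (isCompact_symBox m b)

lemma integral_symBox_succ {m : ℕ} {b : ℝ} (hb : 0 ≤ b) {F : (Fin (m + 1) → ℝ) → ℝ}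
    (hF : Continuous F) :
    ∫ z in symBox (m + 1) b, F z = ∫ x in (-b)..b, ∫ y in symBox m b, F (Fin.cons x y) := by
  have hcons : ∀ z : ℝ × (Fin m → ℝ),
      (MeasurableEquiv.piFinSuccAbove (fun _ : Fin (m + 1) => ℝ) 0).symm z =
        Fin.cons z.1 z.2 := by
    intro z
    simp [MeasurableEquiv.piFinSuccAbove, Fin.insertNthEquiv]
  have e := (volume_preserving_piFinSuccAbove (fun _ : Fin (m + 1) => ℝ) 0).symm
  have h1 := e.setIntegral_preimage_emb (MeasurableEquiv.measurableEmbedding _) F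
    (symBox (m + 1) b)
  have h2 : (MeasurableEquiv.piFinSuccAbove (fun _ : Fin (m + 1) => ℝ) 0).symm ⁻¹'
      (symBox (m + 1) b) = Set.Icc (-b) b ×ˢ symBox m b := by
    ext ⟨x, y⟩
    simp only [Set.mem_preimage, mem_symBox, Set.mem_prod, Fin.forall_fin_succ]
    simp [abs_le]
  rw [← h1, h2, Measure.volume_eq_prod, setIntegral_prod]
  · rw [intervalIntegral.integral_of_le (by linarith), ← integral_Icc_eq_integral_Ioc]
    simp only [hcons]
  · refine ContinuousOn.integrableOn_compact (isCompact_Icc.prod (isCompact_symBox m b)) ?_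
    simp only [hcons]
    exact (hF.comp (continuous_fin_cons m)).continuousOn

lemma integral_symBox_zero {b : ℝ} (F : (Fin 0 → ℝ) → ℝ) :
    ∫ z in symBox 0 b, F z = F 0 := by
  have : symBox 0 b = Set.univ := by ext; simp [mem_symBox]
  rw [this, Measure.restrict_univ, integral_unique]
  have h : (volume : Measure (Fin 0 → ℝ)).real Set.univ = 1 := by
    simp [Measure.real, volume_pi]
  rw [h, one_smul]
  exact congrArg F (Subsingleton.elim _ _)

lemma integral_symBox_const_half (m : ℕ) (c : ℝ) : ∫ _ in symBox m (1 / 2), c = c := by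
  induction m with
  | zero => rw [integral_symBox_zero]
  | succ m ih =>
    rw [integral_symBox_succ (by norm_num) continuous_const]
    simp only [ih]
    norm_num [intervalIntegral.integral_const]

/-- One-dimensional monotone transport between two positive continuous densities. -/
lemma exists_monotone_transport {α β : ℝ → ℝ} (hα : Continuous α) (hβ : Continuous β)
    (hα0 : ∀ x, 0 < α x) (hβ0 : ∀ x, 0 < β x) {a b c d p : ℝ} (hcd : c ≤ d)
    (hp : 0 < p) (h : ∫ x in a..b, α x = p * ∫ y in c..d, β y) :
    ∃ T T' : ℝ → ℝ, (∀ x, HasDerivAt T (T' x) x) ∧ Continuous T' ∧ (∀ x, 0 < T' x) ∧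
      T a = c ∧ T b = d ∧ ∀ x ∈ Set.Icc a b, α x = p * (β (T x) * T' x) := by
  set γ : ℝ → ℝ := fun y => β (max c (min d y)) with hγ
  have hγc : Continuous γ := by fun_prop
  have hγ0 : ∀ y, 0 < γ y := fun y => hβ0 _
  obtain ⟨y0, -, hy0⟩ := (isCompact_Icc (a := c) (b := d)).exists_isMinOn
    (Set.nonempty_Icc.2 hcd) hβ.continuousOn
  have hmin : ∀ y, β y0 ≤ γ y := fun y => hy0 ⟨le_max_left _ _, max_le hcd (min_le_left _ _)⟩
  set G : ℝ → ℝ := fun y => ∫ s in c..y, γ s with hG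
  have hGd : ∀ y, HasDerivAt G (γ y) y := fun y => hγc.integral_hasStrictDerivAt c y |>.hasDerivAt
  have hGc : Continuous G := continuous_iff_continuousAt.2 fun y => (hGd y).continuousAt
  have hGm : StrictMono G := strictMono_of_hasDerivAt_pos hGd hγ0
  have hG2 : Monotone (fun y => G y - β y0 * y) := by
    refine monotone_of_hasDerivAt_nonneg (f' := fun y => γ y - β y0) (fun y => ?_) fun y => ?_
    · have := (hGd y).sub ((hasDerivAt_id y).const_mul (β y0))
      simp only [mul_one] at this
      exact this
    · simpa using hmin y
  have hG0 : G c = 0 := by simp [hG]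
  have hGs : Function.Surjective G := by
    refine hGc.surjective ?_ ?_
    · refine Filter.tendsto_atTop_mono' _ (f₁ := fun y => β y0 * y - β y0 * c) ?_ ?_
      · filter_upwards [Filter.eventually_ge_atTop c] with y hy
        have := hG2 hy
        simp only [hG0] at this
        linarith
      · exact Filter.tendsto_atTop_add_const_right _ _
          (Filter.tendsto_id.const_mul_atTop (hβ0 y0))
    · refine Filter.tendsto_atBot_mono' _ (f₁ := fun y => β y0 * y - β y0 * c) ?_ ?_
      · filter_upwards [Filter.eventually_le_atBot c] with y hy
        have := hG2 hy
        simp only [hG0] at this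
        linarith
      · exact Filter.tendsto_atBot_add_const_right _ _
          (Filter.tendsto_id.const_mul_atBot (hβ0 y0))
  set e := hGm.orderIsoOfSurjective G hGs with he
  have hGe : ∀ z, G (e.symm z) = z := fun z => e.apply_symm_apply z
  have hed : ∀ z, HasDerivAt e.symm (γ (e.symm z))⁻¹ z := fun z =>
    HasDerivAt.of_local_left_inverse e.symm.continuous.continuousAt (hGd _) (hγ0 _).ne'
      (Filter.Eventually.of_forall hGe)
  set A : ℝ → ℝ := fun x => p⁻¹ * ∫ s in a..x, α s with hA
  have hAd : ∀ x, HasDerivAt A (p⁻¹ * α x) x := fun x =>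
    (hα.integral_hasStrictDerivAt a x).hasDerivAt.const_mul _
  have hAc : Continuous A := continuous_iff_continuousAt.2 fun y => (hAd y).continuousAt
  have hTd : ∀ x, HasDerivAt (fun x => e.symm (A x))
      ((γ (e.symm (A x)))⁻¹ * (p⁻¹ * α x)) x := fun x => (hed (A x)).comp x (hAd x)
  have hTpos : ∀ x, 0 < (γ (e.symm (A x)))⁻¹ * (p⁻¹ * α x) := fun x => by
    have := hγ0 (e.symm (A x)); have := hα0 x; positivity
  have hTm : StrictMono (fun x => e.symm (A x)) := strictMono_of_hasDerivAt_pos hTd hTpos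
  have hTa : e.symm (A a) = c := by
    apply hGm.injective; rw [hGe, hG0]; simp [hA]
  have hTb : e.symm (A b) = d := by
    apply hGm.injective
    rw [hGe]
    simp only [hA, h, hG]
    rw [inv_mul_cancel_left₀ hp.ne']
    refine intervalIntegral.integral_congr fun y hy => ?_
    rw [Set.uIcc_of_le hcd] at hy
    simp [hγ, hy.1, hy.2]
  refine ⟨fun x => e.symm (A x), _, hTd, ?_, hTpos, hTa, hTb, fun x hx => ?_⟩
  · have h1 : Continuous fun x => e.symm (A x) := e.symm.continuous.comp hAc
    exact ((hγc.comp h1).inv₀ fun x => (hγ0 _).ne').mul (continuous_const.mul hα)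
  · have h1 : c ≤ e.symm (A x) := hTa ▸ hTm.monotone hx.1
    have h2 : e.symm (A x) ≤ d := hTb ▸ hTm.monotone hx.2
    have h3 : γ (e.symm (A x)) = β (e.symm (A x)) := by simp [hγ, h1, h2]
    have := hβ0 (e.symm (A x))
    simp only [h3]
    field_simp

lemma hasDerivAt_cons_left {m : ℕ} {e : (Fin (m + 1) → ℝ) → ℝ} (he : ContDiff ℝ 1 e)
    (x : ℝ) (y : Fin m → ℝ) :
    HasDerivAt (fun x => e (Fin.cons x y)) (fderiv ℝ e (Fin.cons x y) (Pi.single 0 1)) x := by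
  have h1 : HasDerivAt (fun x : ℝ => (Fin.cons x y : Fin (m + 1) → ℝ)) (Pi.single 0 1) x := by
    rw [hasDerivAt_pi]
    intro i
    refine Fin.cases ?_ (fun j => ?_) i
    · simpa using! hasDerivAt_id x
    · simpa using hasDerivAt_const x (y j)
  exact ((he.differentiable one_ne_zero) _).hasFDerivAt.comp_hasDerivAt x h1

lemma contDiff_cons_right {m : ℕ} (x : ℝ) :
    ContDiff ℝ 1 (fun y : Fin m → ℝ => (Fin.cons x y : Fin (m + 1) → ℝ)) := by
  rw [contDiff_pi]
  intro i
  refine Fin.cases ?_ (fun j => ?_) i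
  · simpa using contDiff_const
  · simpa using contDiff_apply ℝ ℝ j

lemma fderiv_cons_right {m : ℕ} {e : (Fin (m + 1) → ℝ) → ℝ} (he : ContDiff ℝ 1 e)
    (x : ℝ) (y : Fin m → ℝ) (i : Fin m) :
    fderiv ℝ (fun y => e (Fin.cons x y)) y (Pi.single i 1) =
      fderiv ℝ e (Fin.cons x y) (Pi.single i.succ 1) := by
  have h1 : HasFDerivAt (fun y : Fin m → ℝ => (Fin.cons x y : Fin (m + 1) → ℝ))
      (ContinuousLinearMap.pi (Fin.cons (0 : (Fin m → ℝ) →L[ℝ] ℝ) fun j =>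
        ContinuousLinearMap.proj (R := ℝ) (φ := fun _ : Fin m => ℝ) j)) y := by
    rw [hasFDerivAt_pi]
    intro i
    refine Fin.cases ?_ (fun j => ?_) i
    · simpa using hasFDerivAt_const x y
    · simpa using! (ContinuousLinearMap.proj (R := ℝ) (φ := fun _ : Fin m => ℝ) j).hasFDerivAt
  have h2 := ((he.differentiable one_ne_zero) _).hasFDerivAt.comp y h1
  have h3 := h2.fderiv
  simp only [Function.comp_def] at h3
  rw [h3, ContinuousLinearMap.comp_apply]
  congr 1
  ext j
  refine Fin.cases ?_ (fun j => ?_) j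
  · simp [ContinuousLinearMap.pi_apply]
  · simp [ContinuousLinearMap.pi_apply, Pi.single_apply]

lemma continuous_fderiv_apply_const {m : ℕ} {e : (Fin m → ℝ) → ℝ} (he : ContDiff ℝ 1 e)
    (v : Fin m → ℝ) : Continuous fun x => fderiv ℝ e x v :=
  (he.continuous_fderiv one_ne_zero).clm_apply continuous_const

lemma hasDerivAt_integral_symBox {m : ℕ} {b : ℝ} {e : (Fin (m + 1) → ℝ) → ℝ}
    (he : ContDiff ℝ 1 e) (x : ℝ) :
    HasDerivAt (fun x => ∫ y in symBox m b, e (Fin.cons x y))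
      (∫ y in symBox m b, fderiv ℝ e (Fin.cons x y) (Pi.single 0 1)) x := by
  have hc : Continuous (fun p : ℝ × (Fin m → ℝ) => e (Fin.cons p.1 p.2)) :=
    he.continuous.comp (continuous_fin_cons m)
  have hc' : Continuous (fun p : ℝ × (Fin m → ℝ) =>
      fderiv ℝ e (Fin.cons p.1 p.2) (Pi.single 0 1)) :=
    (continuous_fderiv_apply_const he _).comp (continuous_fin_cons m)
  obtain ⟨C, hC⟩ := ((isCompact_Icc (a := x - 1) (b := x + 1)).prod
    (isCompact_symBox m b)).exists_bound_of_continuousOn hc'.continuousOn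
  refine (hasDerivAt_integral_of_dominated_loc_of_deriv_le (𝕜 := ℝ) (bound := fun _ => C)
    (F := fun x y => e (Fin.cons x y))
    (F' := fun x y => fderiv ℝ e (Fin.cons x y) (Pi.single 0 1))
    (Icc_mem_nhds (show x - 1 < x by linarith) (show x < x + 1 by linarith))
    (Filter.Eventually.of_forall fun x' => ?_) ?_ ?_ ?_ ?_ ?_).2
  · exact (hc.comp (Continuous.prodMk_right x')).aestronglyMeasurable
  · exact ((hc.comp (Continuous.prodMk_right x)).continuousOn).integrableOn_compact
      (isCompact_symBox m b)
  · exact (hc'.comp (Continuous.prodMk_right x)).aestronglyMeasurable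
  · refine (ae_restrict_iff' (measurableSet_symBox m b)).2 (Filter.Eventually.of_forall ?_)
    intro y hy x' hx'
    exact hC (x', y) ⟨hx', hy⟩
  · exact integrableOn_const (isCompact_symBox m b).measure_ne_top
  · exact Filter.Eventually.of_forall fun y x' _ => hasDerivAt_cons_left he x' y

lemma setIntegral_symBox_mono {m : ℕ} {b : ℝ} {F G : (Fin m → ℝ) → ℝ} (hF : Continuous F)
    (hG : Continuous G) (h : ∀ x ∈ symBox m b, F x ≤ G x) :
    ∫ x in symBox m b, F x ≤ ∫ x in symBox m b, G x :=
  setIntegral_mono_on (hF.continuousOn.integrableOn_compact (isCompact_symBox m b))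
    (hG.continuousOn.integrableOn_compact (isCompact_symBox m b)) (measurableSet_symBox m b) h

/-- Integration by parts of the first component of the transport against the fibre mass, the
remainder being absorbed by Young's inequality. -/
lemma transport_by_parts {m : ℕ} {f e : (Fin (m + 1) → ℝ) → ℝ} (hf : Continuous f)
    (he : ContDiff ℝ 1 e) (hf0 : ∀ x, 0 < f x) {δ lam M : ℝ} (hlam : 0 < lam) (hM : 0 ≤ M)
    (hδ : ∀ x ∈ symBox (m + 1) (1 / 2), ∀ i, |x i| = 1 / 2 → e x ≤ δ)
    {T T' : ℝ → ℝ} (hT : ∀ x, HasDerivAt T (T' x) x) (hT' : Continuous T')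
    (ha : T (-(1 / 2)) = -M) (hb : T (1 / 2) = M) :
    ∫ x in (-(1 / 2 : ℝ))..(1 / 2), T' x * ∫ y in symBox m (1 / 2), e (Fin.cons x y) ≤
      2 * M * δ +
      (4 * lam)⁻¹ * (∫ x in (-(1 / 2 : ℝ))..(1 / 2), ∫ y in symBox m (1 / 2),
        (fderiv ℝ e (Fin.cons x y) (Pi.single 0 1)) ^ 2 / f (Fin.cons x y)) +
      lam * ∫ x in (-(1 / 2 : ℝ))..(1 / 2), T x ^ 2 * ∫ y in symBox m (1 / 2),
        f (Fin.cons x y) := by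
  have hTc : Continuous T := continuous_iff_continuousAt.2 fun y => (hT y).continuousAt
  have hcons := continuous_fin_cons m
  have hD := continuous_fderiv_apply_const he (Pi.single 0 1)
  have c1 : Continuous fun x => ∫ y in symBox m (1 / 2), e (Fin.cons x y) :=
    continuous_integral_symBox (he.continuous.comp hcons)
  have c2 : Continuous fun x => ∫ y in symBox m (1 / 2),
      fderiv ℝ e (Fin.cons x y) (Pi.single 0 1) :=
    continuous_integral_symBox (hD.comp hcons)
  have c3 : Continuous fun x => ∫ y in symBox m (1 / 2),
      (fderiv ℝ e (Fin.cons x y) (Pi.single 0 1)) ^ 2 / f (Fin.cons x y) :=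
    continuous_integral_symBox (((hD.pow 2).div hf fun x => (hf0 x).ne').comp hcons)
  have c4 : Continuous fun x => ∫ y in symBox m (1 / 2), f (Fin.cons x y) :=
    continuous_integral_symBox (hf.comp hcons)
  have c5 : Continuous fun x => T' x * ∫ y in symBox m (1 / 2), e (Fin.cons x y) := hT'.mul c1
  have c6 : Continuous fun x => T x * ∫ y in symBox m (1 / 2),
      fderiv ℝ e (Fin.cons x y) (Pi.single 0 1) := hTc.mul c2
  have c7 : Continuous fun x => (4 * lam)⁻¹ * ∫ y in symBox m (1 / 2),
      (fderiv ℝ e (Fin.cons x y) (Pi.single 0 1)) ^ 2 / f (Fin.cons x y) :=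
    continuous_const.mul c3
  have c8 : Continuous fun x => lam * (T x ^ 2 * ∫ y in symBox m (1 / 2), f (Fin.cons x y)) :=
    continuous_const.mul ((hTc.pow 2).mul c4)
  have hparts := intervalIntegral.integral_deriv_mul_eq_sub (a := -(1 / 2 : ℝ)) (b := 1 / 2)
    (fun x _ => hT x)
    (fun x _ => hasDerivAt_integral_symBox (b := 1 / 2) he x) (hT'.intervalIntegrable _ _)
    (c2.intervalIntegrable _ _)
  rw [intervalIntegral.integral_add (c5.intervalIntegrable _ _)
    (c6.intervalIntegrable _ _), ha, hb] at hparts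
  have hbd : ∀ s : ℝ, |s| = 1 / 2 → ∫ y in symBox m (1 / 2), e (Fin.cons s y) ≤ δ := by
    intro s hs
    rw [← integral_symBox_const_half m δ]
    refine setIntegral_symBox_mono
      (he.continuous.comp (hcons.comp (Continuous.prodMk_right s))) continuous_const ?_
    intro y hy
    refine hδ _ ?_ 0 (by simpa using hs)
    rw [mem_symBox] at hy ⊢
    intro i
    refine Fin.cases ?_ (fun j => ?_) i
    · simpa using hs.le
    · simpa using hy j
  have hb1 := mul_le_mul_of_nonneg_left (hbd (1 / 2) (by norm_num [abs_of_pos])) hM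
  have hb2 := mul_le_mul_of_nonneg_left (hbd (-(1 / 2)) (by norm_num [abs_of_pos])) hM
  have hY : ∫ x in (-(1 / 2 : ℝ))..(1 / 2), -(T x * ∫ y in symBox m (1 / 2),
      fderiv ℝ e (Fin.cons x y) (Pi.single 0 1)) ≤
      ∫ x in (-(1 / 2 : ℝ))..(1 / 2), ((4 * lam)⁻¹ * (∫ y in symBox m (1 / 2),
        (fderiv ℝ e (Fin.cons x y) (Pi.single 0 1)) ^ 2 / f (Fin.cons x y)) +
        lam * (T x ^ 2 * ∫ y in symBox m (1 / 2), f (Fin.cons x y))) := by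
    refine intervalIntegral.integral_mono_on (by norm_num)
      (c6.neg.intervalIntegrable _ _)
      ((c7.add c8).intervalIntegrable _ _) ?_
    intro x _
    have i1 : ∀ {F : (Fin (m + 1) → ℝ) → ℝ}, Continuous F →
        IntegrableOn (fun y => F (Fin.cons x y)) (symBox m (1 / 2)) := fun {F} hF =>
      ((hF.comp (hcons.comp (Continuous.prodMk_right x))).continuousOn).integrableOn_compact
        (isCompact_symBox m _)
    have j1 : Integrable (fun y => (4 * lam)⁻¹ *
        ((fderiv ℝ e (Fin.cons x y) (Pi.single 0 1)) ^ 2 / f (Fin.cons x y)))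
        (volume.restrict (symBox m (1 / 2))) :=
      (i1 ((hD.pow 2).div hf fun x => (hf0 x).ne')).const_mul _
    have j2 : Integrable (fun y => lam * (T x ^ 2 * f (Fin.cons x y)))
        (volume.restrict (symBox m (1 / 2))) := ((i1 hf).const_mul _).const_mul _
    rw [← integral_const_mul, ← integral_const_mul, ← integral_const_mul, ← integral_const_mul,
      ← integral_neg, ← integral_add j1 j2]
    refine setIntegral_mono ((i1 hD).const_mul _).neg (j1.add j2) ?_
    intro y
    have h0 := hf0 (Fin.cons x y)
    have : (4 * lam)⁻¹ * ((fderiv ℝ e (Fin.cons x y) (Pi.single 0 1)) ^ 2 / f (Fin.cons x y)) +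
        lam * (T x ^ 2 * f (Fin.cons x y)) -
        -(T x * fderiv ℝ e (Fin.cons x y) (Pi.single 0 1)) =
        (4 * lam * f (Fin.cons x y))⁻¹ * (fderiv ℝ e (Fin.cons x y) (Pi.single 0 1) +
          2 * lam * f (Fin.cons x y) * T x) ^ 2 := by
      field_simp
      ring
    have h2 : 0 ≤ (4 * lam * f (Fin.cons x y))⁻¹ *
        (fderiv ℝ e (Fin.cons x y) (Pi.single 0 1) + 2 * lam * f (Fin.cons x y) * T x) ^ 2 := by
      positivity
    simp only
    linarith
  rw [intervalIntegral.integral_neg, intervalIntegral.integral_add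
    (c7.intervalIntegrable _ _) (c8.intervalIntegrable _ _),
    intervalIntegral.integral_const_mul, intervalIntegral.integral_const_mul] at hY
  linarith

lemma integral_symBox_pos {m : ℕ} {b : ℝ} (hb : 0 < b) {F : (Fin m → ℝ) → ℝ}
    (hF : Continuous F) (hF0 : ∀ x, 0 < F x) : 0 < ∫ x in symBox m b, F x := by
  induction m with
  | zero => simpa only [integral_symBox_zero] using hF0 0
  | succ m ih =>
    rw [integral_symBox_succ hb.le hF]
    have hc : Continuous fun x => ∫ y in symBox m b, F (Fin.cons x y) :=
      continuous_integral_symBox (hF.comp (continuous_fin_cons m))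
    refine intervalIntegral.intervalIntegral_pos_of_pos_on (hc.intervalIntegrable _ _)
      (fun x _ => ?_) (by linarith)
    · exact ih (hF.comp ((continuous_fin_cons m).comp (Continuous.prodMk_right x))) fun _ => hF0 _

lemma intervalIntegral_le_sum_five {a b K : ℝ} (hab : a ≤ b) {A B C D E : ℝ → ℝ}
    (hA : Continuous A) (hB : Continuous B) (hC : Continuous C) (hD : Continuous D)
    (hE : Continuous E) (h : ∀ x ∈ Set.Icc a b, A x ≤ B x + C x + K + D x + E x) :
    ∫ x in a..b, A x ≤ (∫ x in a..b, B x) + (∫ x in a..b, C x) + (b - a) * K +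
      (∫ x in a..b, D x) + ∫ x in a..b, E x := by
  have c1 : Continuous fun x => B x + C x := hB.add hC
  have c2 : Continuous fun x => B x + C x + K := c1.add continuous_const
  have c3 : Continuous fun x => B x + C x + K + D x := c2.add hD
  have c4 : Continuous fun x => B x + C x + K + D x + E x := c3.add hE
  have h1 := intervalIntegral.integral_mono_on hab (hA.intervalIntegrable (μ := volume) _ _)
    (c4.intervalIntegrable _ _) h
  rw [intervalIntegral.integral_add (c3.intervalIntegrable _ _) (hE.intervalIntegrable _ _),
    intervalIntegral.integral_add (c2.intervalIntegrable _ _) (hD.intervalIntegrable _ _),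
    intervalIntegral.integral_add (c1.intervalIntegrable _ _)
      (continuous_const.intervalIntegrable _ _),
    intervalIntegral.integral_add (hB.intervalIntegrable _ _) (hC.intervalIntegrable _ _),
    intervalIntegral.integral_const, smul_eq_mul] at h1
  exact h1

/-- Inequality obtained from the triangular (Knothe) transport between two positive densities on
cubes, proved by induction on the dimension. The parameter `N` is the final dimension, and `S`, `p`
record the sum and product of the diagonal derivatives already produced. -/
theorem knothe_box_inequality {N : ℝ} {M δ lam : ℝ} (hM : 0 < M) (hlam : 0 < lam) :
    ∀ (m : ℕ) (f e g : (Fin m → ℝ) → ℝ), Continuous f → ContDiff ℝ 1 e → Continuous g →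
    (∀ x, 0 < f x) → (∀ y, 0 < g y) → (∀ x, e x = f x ^ (1 - 1 / N)) →
    (∀ x ∈ symBox m (1 / 2), ∀ i, |x i| = 1 / 2 → e x ≤ δ) →
    ∀ p S : ℝ, 0 < p →
    (∀ d : Fin m → ℝ, (∀ i, 0 < d i) → N * (p * ∏ i, d i) ^ (1 / N) ≤ S + ∑ i, d i) →
    ∫ x in symBox m (1 / 2), f x = p * ∫ y in symBox m M, g y →
    N * p * ∫ y in symBox m M, g y ^ (1 - 1 / N) ≤
      S * (∫ x in symBox m (1 / 2), e x) + m * (2 * M * δ) +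
      (4 * lam)⁻¹ * (∫ x in symBox m (1 / 2),
        (∑ i, (fderiv ℝ e x (Pi.single i 1)) ^ 2) / f x) +
      lam * p * ∫ y in symBox m M, g y * ∑ i, y i ^ 2 := by
  intro m
  induction m with
  | zero =>
    intro f e g hf he hg hf0 hg0 hef hδ p S hp hS hmass
    simp only [integral_symBox_zero] at hmass ⊢
    have h1 := hS 0 (fun i => i.elim0)
    simp only [Finset.univ_eq_empty, Finset.prod_empty, mul_one, Finset.sum_empty,
      add_zero] at h1
    have hg := hg0 0
    rw [hef, hmass, mul_rpow hp.le hg.le]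
    have h2 : p = p ^ (1 / N) * p ^ (1 - 1 / N) := by
      rw [← rpow_add hp]; simp
    have h3 : N * p * g 0 ^ (1 - 1 / N) ≤ S * (p ^ (1 - 1 / N) * g 0 ^ (1 - 1 / N)) := by
      calc N * p * g 0 ^ (1 - 1 / N)
          = (N * p ^ (1 / N)) * (p ^ (1 - 1 / N) * g 0 ^ (1 - 1 / N)) := by
            nth_rewrite 1 [h2]; ring
        _ ≤ _ := by
            refine mul_le_mul_of_nonneg_right h1 (by positivity)
    simpa using h3
  | succ m ih =>
    intro f e g hf he hg hf0 hg0 hef hδ p S hp hS hmass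
    have hcons := continuous_fin_cons m
    have hDi := fun i => continuous_fderiv_apply_const he (Pi.single i 1)
    have hgq : Continuous fun y => g y ^ (1 - 1 / N) :=
      hg.rpow_const fun y => Or.inl (hg0 y).ne'
    have hpos : ∀ (b : ℝ) (F : (Fin (m + 1) → ℝ) → ℝ), 0 < b → Continuous F → (∀ x, 0 < F x) →
        ∀ x, 0 < ∫ y in symBox m b, F (Fin.cons x y) := fun b F hb hF hF0 x =>
      integral_symBox_pos hb (hF.comp (hcons.comp (Continuous.prodMk_right x))) fun _ => hF0 _
    have c1 : Continuous fun x => ∫ y in symBox m (1 / 2), f (Fin.cons x y) :=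
      continuous_integral_symBox (hf.comp hcons)
    have c2 : Continuous fun x => ∫ y in symBox m M, g (Fin.cons x y) :=
      continuous_integral_symBox (hg.comp hcons)
    rw [integral_symBox_succ (by norm_num) hf, integral_symBox_succ hM.le hg] at hmass
    obtain ⟨T, T', hT, hT', hT0, hTa, hTb, hTe⟩ := exists_monotone_transport c1 c2
      (hpos _ f (by norm_num) hf hf0) (hpos _ g hM hg hg0) (by linarith) hp hmass
    have hTc : Continuous T := continuous_iff_continuousAt.2 fun y => (hT y).continuousAt
    have hsub : ∀ F : ℝ → ℝ, Continuous F →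
        ∫ x in (-(1 / 2 : ℝ))..(1 / 2), T' x * F (T x) = ∫ y in (-M)..M, F y := by
      intro F hF
      rw [← hTa, ← hTb, ← intervalIntegral.integral_comp_mul_deriv (fun x _ => hT x)
        hT'.continuousOn hF]
      simp [mul_comm]
    have hby := transport_by_parts hf he hf0 hlam hM.le hδ hT hT' hTa hTb
    have hδ' : ∀ x ∈ Set.Icc (-(1 / 2 : ℝ)) (1 / 2), ∀ y ∈ symBox m (1 / 2), ∀ i,
        |y i| = 1 / 2 → e (Fin.cons x y) ≤ δ := by
      intro x hx y hy i hi
      refine hδ _ ?_ i.succ (by simpa using hi)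
      rw [mem_symBox] at hy ⊢
      intro i
      refine Fin.cases ?_ (fun j => ?_) i
      · simpa using abs_le.2 hx
      · simpa using hy j
    have hfib : ∀ x ∈ Set.Icc (-(1 / 2 : ℝ)) (1 / 2),
        N * p * (T' x * ∫ y in symBox m M, g (Fin.cons (T x) y) ^ (1 - 1 / N)) ≤
        S * (∫ y in symBox m (1 / 2), e (Fin.cons x y)) +
        T' x * (∫ y in symBox m (1 / 2), e (Fin.cons x y)) + m * (2 * M * δ) +
        (4 * lam)⁻¹ * (∫ y in symBox m (1 / 2),
          (∑ i : Fin m, (fderiv ℝ e (Fin.cons x y) (Pi.single i.succ 1)) ^ 2) / f (Fin.cons x y)) +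
        lam * p * (T' x * ∫ y in symBox m M, g (Fin.cons (T x) y) * ∑ i, y i ^ 2) := by
      intro x hx
      have h1 := ih (fun y => f (Fin.cons x y)) (fun y => e (Fin.cons x y))
        (fun y => g (Fin.cons (T x) y))
        (hf.comp (hcons.comp (Continuous.prodMk_right x)))
        (he.comp (contDiff_cons_right x))
        (hg.comp (hcons.comp (Continuous.prodMk_right (T x))))
        (fun y => hf0 _) (fun y => hg0 _) (fun y => hef _) (hδ' x hx) (p * T' x) (S + T' x)
        (mul_pos hp (hT0 x)) ?_ ?_
      · simp only [fderiv_cons_right he] at h1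
        linarith
      · intro d hd
        have := hS (Fin.cons (T' x) d) (Fin.cases (by simpa using hT0 x) (by simpa using hd))
        rw [Fin.prod_univ_succ, Fin.sum_univ_succ] at this
        simp only [Fin.cons_zero, Fin.cons_succ] at this
        rw [mul_assoc, add_assoc]
        exact this
      · rw [hTe x hx]; ring
    have c3 : Continuous fun x => ∫ y in symBox m (1 / 2), e (Fin.cons x y) :=
      continuous_integral_symBox (he.continuous.comp hcons)
    have c4 : Continuous fun x => ∫ y in symBox m M, g (Fin.cons x y) ^ (1 - 1 / N) :=
      continuous_integral_symBox (hgq.comp hcons)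
    have hG : Continuous fun x => ∫ y in symBox m (1 / 2),
        (∑ i : Fin m, (fderiv ℝ e (Fin.cons x y) (Pi.single i.succ 1)) ^ 2) / f (Fin.cons x y) :=
      continuous_integral_symBox (((continuous_finsetSum _ fun i _ => (hDi (Fin.succ i)).pow 2).div hf
        fun x => (hf0 x).ne').comp hcons)
    have c6 : Continuous fun x => ∫ y in symBox m M, g (Fin.cons x y) * ∑ i, y i ^ 2 :=
      continuous_integral_symBox ((hg.comp hcons).mul (by fun_prop))
    have d1 : Continuous fun x => S * (∫ y in symBox m (1 / 2), e (Fin.cons x y)) :=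
      continuous_const.mul c3
    have d2 : Continuous fun x => T' x * (∫ y in symBox m (1 / 2), e (Fin.cons x y)) :=
      hT'.mul c3
    have d3 : Continuous fun _ : ℝ => m * (2 * M * δ) := continuous_const
    have d4 : Continuous fun x => (4 * lam)⁻¹ * ∫ y in symBox m (1 / 2),
        (∑ i : Fin m, (fderiv ℝ e (Fin.cons x y) (Pi.single i.succ 1)) ^ 2) /
          f (Fin.cons x y) := continuous_const.mul hG
    have d5 : Continuous fun x => lam * p * (T' x * ∫ y in symBox m M,
        g (Fin.cons (T x) y) * ∑ i, y i ^ 2) :=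
      continuous_const.mul (hT'.mul (c6.comp hTc))
    have d6 : Continuous fun x => N * p * (T' x * ∫ y in symBox m M,
        g (Fin.cons (T x) y) ^ (1 - 1 / N)) := continuous_const.mul (hT'.mul (c4.comp hTc))
    have h_int := intervalIntegral_le_sum_five (by norm_num) d6 d1 d2 d4 d5 hfib
    simp only [intervalIntegral.integral_const_mul] at h_int
    rw [hsub _ c4, hsub _ c6] at h_int
    have hT2 : ∫ x in (-(1 / 2 : ℝ))..(1 / 2), T x ^ 2 * ∫ y in symBox m (1 / 2), f (Fin.cons x y)
        = p * ∫ y in (-M)..M, y ^ 2 * ∫ z in symBox m M, g (Fin.cons y z) := by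
      rw [← hsub _ (by fun_prop), ← intervalIntegral.integral_const_mul]
      refine intervalIntegral.integral_congr fun x hx => ?_
      rw [Set.uIcc_of_le (by norm_num)] at hx
      simp only [hTe x hx]
      ring
    rw [hT2] at hby
    have hcG0 : Continuous fun x => (fderiv ℝ e x (Pi.single 0 1)) ^ 2 / f x :=
      ((hDi 0).pow 2).div hf fun x => (hf0 x).ne'
    have hcG : Continuous fun x =>
        (∑ i : Fin m, (fderiv ℝ e x (Pi.single i.succ 1)) ^ 2) / f x :=
      (continuous_finsetSum _ fun i _ => (hDi (Fin.succ i)).pow 2).div hf fun x => (hf0 x).ne'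
    have hcQ0 : Continuous fun y : Fin (m + 1) → ℝ => g y * y 0 ^ 2 := by fun_prop
    have hcQ : Continuous fun y : Fin (m + 1) → ℝ => g y * ∑ i : Fin m, y i.succ ^ 2 := by
      fun_prop
    have hcomp : ∀ F : (Fin (m + 1) → ℝ) → ℝ, ∀ b, Continuous F → IntegrableOn F (symBox (m + 1) b) :=
      fun F b hF => hF.continuousOn.integrableOn_compact (isCompact_symBox _ _)
    have s1 : ∫ x in symBox (m + 1) (1 / 2),
        (∑ i, (fderiv ℝ e x (Pi.single i 1)) ^ 2) / f x =
        (∫ x in symBox (m + 1) (1 / 2), (fderiv ℝ e x (Pi.single 0 1)) ^ 2 / f x) +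
        ∫ x in symBox (m + 1) (1 / 2),
          (∑ i : Fin m, (fderiv ℝ e x (Pi.single i.succ 1)) ^ 2) / f x := by
      simp only [Fin.sum_univ_succ, add_div]
      exact integral_add (hcomp _ _ hcG0) (hcomp _ _ hcG)
    have s2 : ∫ y in symBox (m + 1) M, g y * ∑ i, y i ^ 2 =
        (∫ y in symBox (m + 1) M, g y * y 0 ^ 2) +
        ∫ y in symBox (m + 1) M, g y * ∑ i : Fin m, y i.succ ^ 2 := by
      simp only [Fin.sum_univ_succ, mul_add]
      exact integral_add (hcomp _ _ hcQ0) (hcomp _ _ hcQ)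
    rw [s1, s2, integral_symBox_succ hM.le hgq, integral_symBox_succ (by norm_num) he.continuous,
      integral_symBox_succ (by norm_num) hcG0, integral_symBox_succ (by norm_num) hcG,
      integral_symBox_succ hM.le hcQ0, integral_symBox_succ hM.le hcQ]
    simp only [Fin.cons_zero, Fin.cons_succ]
    have s3 : ∀ y : ℝ, ∫ z in symBox m M, g (Fin.cons y z) * y ^ 2 =
        y ^ 2 * ∫ z in symBox m M, g (Fin.cons y z) := by
      intro y
      rw [integral_mul_const, mul_comm]
    simp only [s3]
    push_cast
    linarith

lemma integral_exp_neg_mul_sum_sq (n : ℕ) {t : ℝ} (ht : 0 < t) :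
    Integrable (fun y : Fin n → ℝ => exp (-t * ∑ i, y i ^ 2)) ∧
      ∫ y : Fin n → ℝ, exp (-t * ∑ i, y i ^ 2) = (π / t) ^ ((n : ℝ) / 2) := by
  have h : ∀ y : Fin n → ℝ, exp (-t * ∑ i, y i ^ 2) = ∏ i, exp (-t * y i ^ 2) := by
    intro y
    rw [Finset.mul_sum, exp_sum]
  simp only [h]
  constructor
  · exact Integrable.fintype_prod (f := fun _ : Fin n => fun y : ℝ => exp (-t * y ^ 2))
      fun _ => integrable_exp_neg_mul_sq ht
  · rw [integral_fintype_prod_volume_eq_pow (fun y : ℝ => exp (-t * y ^ 2)), integral_gaussian,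
      Fintype.card_fin, sqrt_eq_rpow, ← rpow_natCast, ← rpow_mul (by positivity)]
    congr 1
    ring

lemma lintegral_one_add_sum_sq_rpow {n : ℕ} {s : ℝ} (hs : (n : ℝ) / 2 < s) :
    ∫⁻ y : Fin n → ℝ, ENNReal.ofReal ((1 + ∑ i, y i ^ 2) ^ (-s)) =
      ENNReal.ofReal (π ^ ((n : ℝ) / 2) * Gamma (s - n / 2) / Gamma s) := by
  have hs0 : 0 < s := lt_of_le_of_lt (by positivity) hs
  have hG : 0 < Gamma s := Gamma_pos_of_pos hs0
  have hin : ∀ c : ℝ, 0 < c → ∀ r : ℝ, 0 < r →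
      ∫⁻ t in Set.Ioi (0 : ℝ), ENNReal.ofReal (t ^ (r - 1) * exp (-(c * t))) =
        ENNReal.ofReal (c ^ (-r) * Gamma r) := by
    intro c hc r hr
    rw [← ofReal_integral_eq_lintegral_ofReal, integral_rpow_mul_exp_neg_mul_Ioi hr hc, one_div,
      inv_rpow hc.le, rpow_neg hc.le]
    · have := integrableOn_rpow_mul_exp_neg_mul_rpow (s := r - 1) (p := 1) (b := c)
        (by linarith) zero_lt_one hc
      simpa [IntegrableOn] using this
    · filter_upwards [ae_restrict_mem measurableSet_Ioi] with t ht
      have : (0 : ℝ) < t := ht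
      positivity
  have h1 : ∀ y : Fin n → ℝ, ENNReal.ofReal ((1 + ∑ i, y i ^ 2) ^ (-s)) =
      ENNReal.ofReal (Gamma s)⁻¹ * ∫⁻ t in Set.Ioi (0 : ℝ),
        ENNReal.ofReal (t ^ (s - 1) * exp (-((1 + ∑ i, y i ^ 2) * t))) := by
    intro y
    rw [hin _ (by positivity) _ hs0, ← ENNReal.ofReal_mul (by positivity)]
    congr 1
    field_simp
  simp only [h1]
  rw [lintegral_const_mul _ (by fun_prop), lintegral_lintegral_swap (by fun_prop)]
  have h2 : ∀ t ∈ Set.Ioi (0 : ℝ), ∫⁻ y : Fin n → ℝ,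
      ENNReal.ofReal (t ^ (s - 1) * exp (-((1 + ∑ i, y i ^ 2) * t))) =
      ENNReal.ofReal (π ^ ((n : ℝ) / 2)) *
        ENNReal.ofReal (t ^ (s - n / 2 - 1) * exp (-(1 * t))) := by
    intro t ht
    have ht : 0 < t := ht
    obtain ⟨i1, i2⟩ := integral_exp_neg_mul_sum_sq n ht
    have h3 : ∀ y : Fin n → ℝ, t ^ (s - 1) * exp (-((1 + ∑ i, y i ^ 2) * t)) =
        t ^ (s - 1) * exp (-t) * exp (-t * ∑ i, y i ^ 2) := by
      intro y
      rw [mul_assoc, ← exp_add]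
      ring_nf
    simp only [h3]
    rw [← ofReal_integral_eq_lintegral_ofReal (i1.const_mul _)
      (Filter.Eventually.of_forall fun y => by positivity), integral_const_mul, i2,
      ← ENNReal.ofReal_mul (by positivity), div_rpow pi_pos.le ht.le, sub_right_comm,
      rpow_sub ht (s - 1)]
    congr 1
    rw [one_mul]
    ring
  rw [setLIntegral_congr_fun measurableSet_Ioi h2, lintegral_const_mul _ (by fun_prop),
    hin 1 one_pos _ (by linarith), ← ENNReal.ofReal_mul (by positivity),
    ← ENNReal.ofReal_mul (by positivity)]
  congr 1
  rw [one_rpow]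
  ring

lemma integral_one_add_sum_sq_rpow {n : ℕ} {s : ℝ} (hs : (n : ℝ) / 2 < s) :
    Integrable (fun y : Fin n → ℝ => (1 + ∑ i, y i ^ 2) ^ (-s)) ∧
      ∫ y : Fin n → ℝ, (1 + ∑ i, y i ^ 2) ^ (-s) =
        π ^ ((n : ℝ) / 2) * Gamma (s - n / 2) / Gamma s := by
  have hs0 : 0 < s := lt_of_le_of_lt (by positivity) hs
  have h := lintegral_one_add_sum_sq_rpow hs
  have hpos : ∀ y : Fin n → ℝ, 0 ≤ (1 + ∑ i, y i ^ 2) ^ (-s) := fun y => by positivity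
  have hc : Continuous (fun y : Fin n → ℝ => (1 + ∑ i, y i ^ 2) ^ (-s)) :=
    (by fun_prop : Continuous fun y : Fin n → ℝ => 1 + ∑ i, y i ^ 2).rpow_const fun y =>
      Or.inl (by positivity)
  have hG := Gamma_pos_of_pos hs0
  have hG' := Gamma_pos_of_pos (sub_pos.2 hs)
  constructor
  · refine ⟨hc.aestronglyMeasurable, ?_⟩
    rw [hasFiniteIntegral_iff_ofReal (Filter.Eventually.of_forall hpos), h]
    exact ENNReal.ofReal_lt_top
  · rw [integral_eq_lintegral_of_nonneg_ae (Filter.Eventually.of_forall hpos)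
      hc.aestronglyMeasurable, h, ENNReal.toReal_ofReal (by positivity)]

lemma card_mul_prod_rpow_le_sum {n : ℕ} (hn : 0 < n) (d : Fin n → ℝ) (hd : ∀ i, 0 < d i) :
    (n : ℝ) * (∏ i, d i) ^ (1 / (n : ℝ)) ≤ ∑ i, d i := by
  have hn' : (0 : ℝ) < n := by exact_mod_cast hn
  have h := geom_mean_le_arith_mean_weighted Finset.univ (fun _ : Fin n => 1 / (n : ℝ)) d
    (fun _ _ => by positivity) (by simp [hn'.ne']) fun i _ => (hd i).le
  rw [finsetProd_rpow _ _ fun i _ => (hd i).le, ← Finset.mul_sum] at h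
  calc _ ≤ (n : ℝ) * (1 / n * ∑ i, d i) := mul_le_mul_of_nonneg_left h hn'.le
    _ = _ := by field_simp

lemma fderiv_sq_add_rpow_sq_div_le {n : ℕ} {w : (Fin n → ℝ) → ℝ} (hw : ContDiff ℝ 1 w)
    {c N : ℝ} (hc : 0 < c) (hN : 2 < N) (x v : Fin n → ℝ) :
    (fderiv ℝ (fun x => (w x ^ 2 + c) ^ ((N - 1) / (N - 2))) x v) ^ 2 /
      (w x ^ 2 + c) ^ (N / (N - 2)) ≤
      4 * ((N - 1) / (N - 2)) ^ 2 * (fderiv ℝ w x v) ^ 2 := by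
  have hN' : 0 < N - 2 := by linarith
  set q := (N - 1) / (N - 2) with hq
  have hpos : 0 < w x ^ 2 + c := by positivity
  have h1 : HasDerivAt (fun t : ℝ => (t ^ 2 + c) ^ q)
      (2 * w x * q * (w x ^ 2 + c) ^ (q - 1)) (w x) := by
    have := (((hasDerivAt_pow 2 (w x)).add_const c).rpow_const (p := q) (Or.inl hpos.ne'))
    simpa using this
  have h2 := (h1.comp_hasFDerivAt x (hw.differentiable one_ne_zero x).hasFDerivAt).fderiv
  have h3 : fderiv ℝ (fun x => (w x ^ 2 + c) ^ q) x v =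
      2 * w x * q * (w x ^ 2 + c) ^ (q - 1) * fderiv ℝ w x v := by
    change fderiv ℝ ((fun t : ℝ => (t ^ 2 + c) ^ q) ∘ w) x v = _
    rw [h2]
    simp
  have h4 : ((w x ^ 2 + c) ^ (q - 1)) ^ 2 * (w x ^ 2 + c) = (w x ^ 2 + c) ^ (N / (N - 2)) := by
    rw [← rpow_natCast, ← rpow_mul hpos.le, ← rpow_add_one hpos.ne']
    congr 1
    rw [hq]
    push_cast
    field_simp
    ring
  have h5 : 0 < (w x ^ 2 + c) ^ (q - 1) := rpow_pos_of_pos hpos _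
  rw [h3, div_le_iff₀ (rpow_pos_of_pos hpos _), ← h4]
  have : 0 ≤ q ^ 2 * (fderiv ℝ w x v) ^ 2 * ((w x ^ 2 + c) ^ (q - 1)) ^ 2 * c := by positivity
  linarith

lemma knothe_regularized {n : ℕ} (hn : 3 ≤ n) {w : (Fin n → ℝ) → ℝ} (hw : ContDiff ℝ 1 w)
    (hw0 : ∀ x ∈ symBox n (1 / 2), ∀ i, |x i| = 1 / 2 → w x = 0)
    {M lam c : ℝ} (hM : 0 < M) (hlam : 0 < lam) (hc : 0 < c) :
    (n : ℝ) * ((∫ x in symBox n (1 / 2), (w x ^ 2 + c) ^ ((n : ℝ) / (n - 2))) /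
        ∫ y in symBox n M, (1 + ∑ i, y i ^ 2) ^ (-(n : ℝ))) ^ (1 - 1 / (n : ℝ)) *
        (∫ y in symBox n M, (1 + ∑ i, y i ^ 2) ^ (-((n : ℝ) - 1))) ≤
      n * (2 * M * c ^ (((n : ℝ) - 1) / (n - 2))) +
      lam⁻¹ * (((n : ℝ) - 1) / (n - 2)) ^ 2 *
        (∫ x in symBox n (1 / 2), ∑ i, (fderiv ℝ w x (Pi.single i 1)) ^ 2) +
      lam * ((∫ x in symBox n (1 / 2), (w x ^ 2 + c) ^ ((n : ℝ) / (n - 2))) /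
        ∫ y in symBox n M, (1 + ∑ i, y i ^ 2) ^ (-(n : ℝ))) *
        ((∫ y in symBox n M, (1 + ∑ i, y i ^ 2) ^ (-((n : ℝ) - 1))) -
          ∫ y in symBox n M, (1 + ∑ i, y i ^ 2) ^ (-(n : ℝ))) := by
  have hN : (3 : ℝ) ≤ n := by exact_mod_cast hn
  set N : ℝ := (n : ℝ) with hNdef
  have hN2 : 0 < N - 2 := by linarith
  have hQc : ∀ r : ℝ, Continuous fun y : Fin n → ℝ => (1 + ∑ i, y i ^ 2) ^ r := fun r =>
    (by fun_prop : Continuous fun y : Fin n → ℝ => 1 + ∑ i, y i ^ 2).rpow_const fun y =>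
      Or.inl (by positivity)
  have hfc : ∀ r : ℝ, Continuous fun x => (w x ^ 2 + c) ^ r := fun r =>
    ((hw.continuous.pow 2).add continuous_const).rpow_const fun x =>
      Or.inl (by positivity : w x ^ 2 + c ≠ 0)
  have hec : ContDiff ℝ 1 fun x => (w x ^ 2 + c) ^ ((N - 1) / (N - 2)) :=
    ((hw.pow 2).add contDiff_const).rpow_const_of_ne fun x =>
      (by positivity : w x ^ 2 + c ≠ 0)
  have hm : 0 < ∫ x in symBox n (1 / 2), (w x ^ 2 + c) ^ (N / (N - 2)) :=
    integral_symBox_pos (by norm_num) (hfc _) fun x => by positivity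
  have hA : 0 < ∫ y in symBox n M, (1 + ∑ i, y i ^ 2) ^ (-N) :=
    integral_symBox_pos hM (hQc _) fun x => by positivity
  set m := ∫ x in symBox n (1 / 2), (w x ^ 2 + c) ^ (N / (N - 2))
  set A := ∫ y in symBox n M, (1 + ∑ i, y i ^ 2) ^ (-N)
  set κ := m / A with hκ
  have hκ0 : 0 < κ := div_pos hm hA
  have h := knothe_box_inequality (N := N) (δ := c ^ ((N - 1) / (N - 2))) hM hlam n
    (fun x => (w x ^ 2 + c) ^ (N / (N - 2))) (fun x => (w x ^ 2 + c) ^ ((N - 1) / (N - 2)))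
    (fun y => κ * (1 + ∑ i, y i ^ 2) ^ (-N)) (hfc _) hec (continuous_const.mul (hQc _))
    (fun x => by positivity) (fun y => by positivity) ?_ ?_ 1 0 one_pos ?_ ?_
  · have e1 : ∀ y : Fin n → ℝ, (κ * (1 + ∑ i, y i ^ 2) ^ (-N)) ^ (1 - 1 / N) =
        κ ^ (1 - 1 / N) * (1 + ∑ i, y i ^ 2) ^ (-(N - 1)) := by
      intro y
      rw [mul_rpow hκ0.le (by positivity), ← rpow_mul (by positivity)]
      congr 2
      field_simp
    have e2 : ∀ y : Fin n → ℝ, κ * (1 + ∑ i, y i ^ 2) ^ (-N) * ∑ i, y i ^ 2 =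
        κ * ((1 + ∑ i, y i ^ 2) ^ (-(N - 1)) - (1 + ∑ i, y i ^ 2) ^ (-N)) := by
      intro y
      have : (1 + ∑ i, y i ^ 2) ^ (-(N - 1)) =
          (1 + ∑ i, y i ^ 2) ^ (-N) * (1 + ∑ i, y i ^ 2) := by
        rw [← rpow_add_one (by positivity)]
        congr 1
        ring
      rw [this]
      ring
    have hloc : ∀ r : ℝ, IntegrableOn (fun y : Fin n → ℝ => (1 + ∑ i, y i ^ 2) ^ r)
        (symBox n M) := fun r => (hQc r).continuousOn.integrableOn_compact (isCompact_symBox _ _)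
    simp only [e1, e2, integral_const_mul] at h
    rw [integral_sub (hloc _) (hloc _)] at h
    have e3 : ∫ x in symBox n (1 / 2),
        (∑ i, (fderiv ℝ (fun x => (w x ^ 2 + c) ^ ((N - 1) / (N - 2))) x (Pi.single i 1)) ^ 2) /
          (w x ^ 2 + c) ^ (N / (N - 2)) ≤
        4 * ((N - 1) / (N - 2)) ^ 2 *
          ∫ x in symBox n (1 / 2), ∑ i, (fderiv ℝ w x (Pi.single i 1)) ^ 2 := by
      rw [← integral_const_mul]
      refine setIntegral_symBox_mono ?_ ?_ fun x _ => ?_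
      · exact (continuous_finsetSum _ fun i _ => (continuous_fderiv_apply_const hec _).pow 2).div
          (hfc _) fun x => by positivity
      · exact continuous_const.mul
          (continuous_finsetSum _ fun i _ => (continuous_fderiv_apply_const hw _).pow 2)
      · rw [Finset.sum_div, Finset.mul_sum]
        exact Finset.sum_le_sum fun i _ => fderiv_sq_add_rpow_sq_div_le hw hc (by linarith) x _
    have e4 := mul_le_mul_of_nonneg_left e3 (by positivity : 0 ≤ (4 * lam)⁻¹)
    have e5 : ∀ z : ℝ, (4 * lam)⁻¹ * (4 * ((N - 1) / (N - 2)) ^ 2 * z) =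
        lam⁻¹ * ((N - 1) / (N - 2)) ^ 2 * z := fun z => by
      rw [mul_inv]; ring
    rw [e5] at e4
    linarith
  · intro x
    rw [← rpow_mul (by positivity)]
    congr 1
    field_simp
  · intro x hx i hi
    simp [hw0 x hx i hi]
  · intro d hd
    rw [one_mul, zero_add]
    exact card_mul_prod_rpow_le_sum (by omega) d hd
  · rw [integral_const_mul, one_mul, hκ, div_mul_cancel₀ _ hA.ne']

lemma tendsto_setIntegral_symBox {n : ℕ} {F : (Fin n → ℝ) → ℝ} (hF : Integrable F) :
    Filter.Tendsto (fun j : ℕ => ∫ y in symBox n ((j : ℝ) + 1), F y) Filter.atTop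
      (nhds (∫ y, F y)) := by
  have hU : ⋃ j : ℕ, symBox n ((j : ℝ) + 1) = Set.univ := by
    rw [Set.eq_univ_iff_forall]
    intro y
    obtain ⟨j, hj⟩ := exists_nat_ge ‖y‖
    rw [Set.mem_iUnion]
    refine ⟨j, mem_symBox.2 fun i => ?_⟩
    have := norm_le_pi_norm y i
    rw [norm_eq_abs] at this
    linarith
  have h := tendsto_setIntegral_of_monotone (μ := volume) (f := F)
    (s := fun j : ℕ => symBox n ((j : ℝ) + 1)) (fun j => measurableSet_symBox _ _) ?_
    (by rw [hU]; exact hF.integrableOn)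
  · rwa [hU, setIntegral_univ] at h
  · intro i j hij x hx
    rw [mem_symBox] at hx ⊢
    intro l
    have : (i : ℝ) ≤ j := by exact_mod_cast hij
    linarith [hx l]

lemma knothe_limit {n : ℕ} (hn : 3 ≤ n) {w : (Fin n → ℝ) → ℝ} (hw : ContDiff ℝ 1 w)
    (hw0 : ∀ x ∈ symBox n (1 / 2), ∀ i, |x i| = 1 / 2 → w x = 0) {lam : ℝ} (hlam : 0 < lam) :
    (n : ℝ) * ((∫ x in symBox n (1 / 2), (w x ^ 2) ^ ((n : ℝ) / (n - 2))) /
        ∫ y : Fin n → ℝ, (1 + ∑ i, y i ^ 2) ^ (-(n : ℝ))) ^ (1 - 1 / (n : ℝ)) *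
        (∫ y : Fin n → ℝ, (1 + ∑ i, y i ^ 2) ^ (-((n : ℝ) - 1))) ≤
      lam⁻¹ * (((n : ℝ) - 1) / (n - 2)) ^ 2 *
        (∫ x in symBox n (1 / 2), ∑ i, (fderiv ℝ w x (Pi.single i 1)) ^ 2) +
      lam * ((∫ x in symBox n (1 / 2), (w x ^ 2) ^ ((n : ℝ) / (n - 2))) /
        ∫ y : Fin n → ℝ, (1 + ∑ i, y i ^ 2) ^ (-(n : ℝ))) *
        ((∫ y : Fin n → ℝ, (1 + ∑ i, y i ^ 2) ^ (-((n : ℝ) - 1))) -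
          ∫ y : Fin n → ℝ, (1 + ∑ i, y i ^ 2) ^ (-(n : ℝ))) := by
  have hN : (3 : ℝ) ≤ n := by exact_mod_cast hn
  have hN2 : 0 < (n : ℝ) - 2 := by linarith
  have hexp : 0 ≤ 1 - 1 / (n : ℝ) := by
    rw [sub_nonneg, div_le_one (by linarith)]; linarith
  obtain ⟨iA0, hA0⟩ := integral_one_add_sum_sq_rpow (n := n) (s := n) (by linarith)
  obtain ⟨iA1, hA1⟩ := integral_one_add_sum_sq_rpow (n := n) (s := n - 1) (by linarith)
  have hA0pos : 0 < ∫ y : Fin n → ℝ, (1 + ∑ i, y i ^ 2) ^ (-(n : ℝ)) := by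
    rw [hA0]
    have := Gamma_pos_of_pos (show 0 < (n : ℝ) - n / 2 by linarith)
    have := Gamma_pos_of_pos (show 0 < (n : ℝ) by linarith)
    positivity
  have t0 := tendsto_setIntegral_symBox iA0
  have t1 := tendsto_setIntegral_symBox iA1
  have hmc : Continuous fun c : ℝ =>
      ∫ x in symBox n (1 / 2), (w x ^ 2 + c) ^ ((n : ℝ) / (n - 2)) := by
    refine continuous_integral_symBox ?_
    have h1 : Continuous fun p : ℝ × (Fin n → ℝ) => w p.2 ^ 2 + p.1 :=
      ((hw.continuous.comp continuous_snd).pow 2).add continuous_fst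
    exact h1.rpow_const fun p => Or.inr (by positivity)
  have hreg : ∀ j : ℕ, (n : ℝ) * ((∫ x in symBox n (1 / 2), (w x ^ 2) ^ ((n : ℝ) / (n - 2))) /
        ∫ y in symBox n (j + 1), (1 + ∑ i, y i ^ 2) ^ (-(n : ℝ))) ^ (1 - 1 / (n : ℝ)) *
        (∫ y in symBox n (j + 1), (1 + ∑ i, y i ^ 2) ^ (-((n : ℝ) - 1))) ≤
      lam⁻¹ * (((n : ℝ) - 1) / (n - 2)) ^ 2 *
        (∫ x in symBox n (1 / 2), ∑ i, (fderiv ℝ w x (Pi.single i 1)) ^ 2) +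
      lam * ((∫ x in symBox n (1 / 2), (w x ^ 2) ^ ((n : ℝ) / (n - 2))) /
        ∫ y in symBox n (j + 1), (1 + ∑ i, y i ^ 2) ^ (-(n : ℝ))) *
        ((∫ y in symBox n (j + 1), (1 + ∑ i, y i ^ 2) ^ (-((n : ℝ) - 1))) -
          ∫ y in symBox n (j + 1), (1 + ∑ i, y i ^ 2) ^ (-(n : ℝ))) := by
    intro j
    have hj : (0 : ℝ) < j + 1 := by positivity
    set A0 := ∫ y in symBox n (j + 1), (1 + ∑ i, y i ^ 2) ^ (-(n : ℝ))
    set A1 := ∫ y in symBox n (j + 1), (1 + ∑ i, y i ^ 2) ^ (-((n : ℝ) - 1))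
    set D := ∫ x in symBox n (1 / 2), ∑ i, (fderiv ℝ w x (Pi.single i 1)) ^ 2
    have cL : Continuous fun c : ℝ => (n : ℝ) *
        ((∫ x in symBox n (1 / 2), (w x ^ 2 + c) ^ ((n : ℝ) / (n - 2))) / A0) ^ (1 - 1 / (n : ℝ)) *
          A1 :=
      (continuous_const.mul ((hmc.div_const A0).rpow_const fun _ => Or.inr hexp)).mul
        continuous_const
    have cd : Continuous fun c : ℝ => c ^ (((n : ℝ) - 1) / (n - 2)) :=
      continuous_id.rpow_const fun _ => Or.inr (div_nonneg (by linarith) (by linarith))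
    have cR : Continuous fun c : ℝ =>
        n * (2 * ((j : ℝ) + 1) * c ^ (((n : ℝ) - 1) / (n - 2))) +
        lam⁻¹ * (((n : ℝ) - 1) / (n - 2)) ^ 2 * D +
        lam * ((∫ x in symBox n (1 / 2), (w x ^ 2 + c) ^ ((n : ℝ) / (n - 2))) / A0) *
          (A1 - A0) := by
      have := hmc.div_const A0
      fun_prop
    have h := le_of_tendsto_of_tendsto (b := nhdsWithin (0 : ℝ) (Set.Ioi 0))
      ((cL.tendsto 0).mono_left nhdsWithin_le_nhds) ((cR.tendsto 0).mono_left nhdsWithin_le_nhds)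
      (Filter.eventually_of_mem self_mem_nhdsWithin fun c hc =>
        knothe_regularized hn hw hw0 hj hlam hc)
    simp only [add_zero] at h
    rw [zero_rpow (div_pos (by linarith) hN2).ne', mul_zero, mul_zero, zero_add] at h
    exact h
  have tk := Filter.Tendsto.div (tendsto_const_nhds
    (x := ∫ x in symBox n (1 / 2), (w x ^ 2) ^ ((n : ℝ) / (n - 2)))) t0 hA0pos.ne'
  exact le_of_tendsto_of_tendsto' (((tk.rpow_const (Or.inr hexp)).const_mul (n : ℝ)).mul t1)
    (((tk.const_mul lam).mul (t1.sub t0)).const_add _) hreg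

/-- The sharp Sobolev inequality for functions on the unit cube vanishing on its faces. -/
theorem sobolev_symBox {n : ℕ} (hn : 3 ≤ n) {w : (Fin n → ℝ) → ℝ} (hw : ContDiff ℝ 1 w)
    (hw0 : ∀ x ∈ symBox n (1 / 2), ∀ i, |x i| = 1 / 2 → w x = 0) :
    sobolevConst n * (∫ x in symBox n (1 / 2), (w x ^ 2) ^ ((n : ℝ) / (n - 2))) ^
        (((n : ℝ) - 2) / n) ≤
      ∫ x in symBox n (1 / 2), ∑ i, (fderiv ℝ w x (Pi.single i 1)) ^ 2 := by
  have h := fun lam : ℝ => knothe_limit (lam := lam) hn hw hw0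
  have hN : (3 : ℝ) ≤ n := by exact_mod_cast hn
  have hN2 : 0 < (n : ℝ) - 2 := by linarith
  obtain ⟨-, hA0⟩ := integral_one_add_sum_sq_rpow (n := n) (s := n) (by linarith)
  obtain ⟨-, hA1⟩ := integral_one_add_sum_sq_rpow (n := n) (s := n - 1) (by linarith)
  have hG := Gamma_pos_of_pos (show 0 < (n : ℝ) by linarith)
  have hG2 := Gamma_pos_of_pos (show 0 < (n : ℝ) / 2 by linarith)
  have hm : 0 ≤ ∫ x in symBox n (1 / 2), (w x ^ 2) ^ ((n : ℝ) / (n - 2)) :=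
    setIntegral_nonneg (measurableSet_symBox _ _) fun x _ => by positivity
  have hD : 0 ≤ ∫ x in symBox n (1 / 2), ∑ i, (fderiv ℝ w x (Pi.single i 1)) ^ 2 :=
    setIntegral_nonneg (measurableSet_symBox _ _) fun x _ => by positivity
  rw [show (n : ℝ) - n / 2 = n / 2 by ring] at hA0
  have hA01 : (∫ y : Fin n → ℝ, (1 + ∑ i, y i ^ 2) ^ (-((n : ℝ) - 1))) =
      (∫ y : Fin n → ℝ, (1 + ∑ i, y i ^ 2) ^ (-(n : ℝ))) * (2 * (n - 1) / (n - 2)) := by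
    have e1 := Gamma_add_one (s := (n : ℝ) - 1) (by linarith)
    have e2 := Gamma_add_one (s := (n : ℝ) / 2 - 1) (by linarith)
    rw [sub_add_cancel] at e1 e2
    have := Gamma_pos_of_pos (show 0 < (n : ℝ) - 1 by linarith)
    have : (n : ℝ) / 2 - 1 ≠ 0 := by linarith
    have : (n : ℝ) - 1 ≠ 0 := by linarith
    rw [hA0, hA1, e1, e2, show (n : ℝ) - 1 - n / 2 = n / 2 - 1 by ring]
    field_simp
  rw [hA01] at h
  have hA0pos : 0 < ∫ y : Fin n → ℝ, (1 + ∑ i, y i ^ 2) ^ (-(n : ℝ)) := by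
    rw [hA0]; positivity
  have hS : sobolevConst n = n * (n - 2) *
      (∫ y : Fin n → ℝ, (1 + ∑ i, y i ^ 2) ^ (-(n : ℝ))) ^ (2 / (n : ℝ)) := by
    rw [hA0, sobolevConst, mul_div_assoc, mul_rpow (by positivity) (by positivity),
      ← rpow_mul pi_pos.le, show (n : ℝ) / 2 * (2 / n) = 1 by field_simp, rpow_one]
    ring
  rw [hS]
  clear hA0 hA1 hA01 hS
  generalize (∫ y : Fin n → ℝ, (1 + ∑ i, y i ^ 2) ^ (-(n : ℝ))) = A at *
  generalize (∫ x in symBox n (1 / 2), ∑ i, (fderiv ℝ w x (Pi.single i 1)) ^ 2) = D at *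
  generalize (∫ x in symBox n (1 / 2), (w x ^ 2) ^ ((n : ℝ) / (n - 2))) = m at *
  generalize (n : ℝ) = N at *
  rcases hm.eq_or_lt with hm | hm
  · rw [← hm, zero_rpow (by positivity), mul_zero]
    exact hD
  · have hk : 0 < m / A := div_pos hm hA0pos
    have hN1 : 0 < N - 1 := by linarith
    set z := (m / A) ^ (1 / N) with hz
    have hz0 : 0 < z := rpow_pos_of_pos hk _
    have e1 : (m / A) ^ (1 - 1 / N) = (m / A) / z := by rw [rpow_sub hk, rpow_one]
    have e2 : m ^ ((N - 2) / N) * A ^ (2 / N) = A * (m / A) / z ^ 2 := by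
      have e3 : z ^ 2 = (m / A) ^ (2 / N) := by
        rw [hz, ← rpow_natCast, ← rpow_mul hk.le]
        congr 1
        push_cast
        ring
      rw [e3, div_rpow hm.le hA0pos.le, show (N - 2) / N = 1 - 2 / N by field_simp,
        rpow_sub hm, rpow_one]
      field_simp
    have h1 := h ((N - 1) / z) (by positivity)
    rw [e1] at h1
    generalize m / A = κ at *
    have h2 : N * (N - 2) * (A * κ / z ^ 2) ≤ D := by
      have h3 : (N * (κ / z) * (A * (2 * (N - 1) / (N - 2))) -
          (N - 1) / z * κ * (A * (2 * (N - 1) / (N - 2)) - A)) =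
          (z * (N - 1) / (N - 2) ^ 2) * (N * (N - 2) * (A * κ / z ^ 2)) := by
        field_simp
        ring
      have h4 : ((N - 1) / z)⁻¹ * ((N - 1) / (N - 2)) ^ 2 * D =
          (z * (N - 1) / (N - 2) ^ 2) * D := by
        field_simp
      exact le_of_mul_le_mul_left (a := z * (N - 1) / (N - 2) ^ 2) (by linarith) (by positivity)
    calc _ = N * (N - 2) * (m ^ ((N - 2) / N) * A ^ (2 / N)) := by ring
      _ ≤ D := by rw [e2]; exact h2

lemma inner_gradient_eq_fderiv {n : ℕ} (w : EuclideanSpace ℝ (Fin n) → ℝ)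
    (x v : EuclideanSpace ℝ (Fin n)) : inner ℝ (gradient w x) v = fderiv ℝ w x v := by
  rw [gradient, InnerProductSpace.toDual_symm_apply]

lemma norm_gradient_sq_eq_sum {n : ℕ} (w : EuclideanSpace ℝ (Fin n) → ℝ)
    (x : EuclideanSpace ℝ (Fin n)) :
    ‖gradient w x‖ ^ 2 = ∑ i, (fderiv ℝ w x (EuclideanSpace.single i 1)) ^ 2 := by
  rw [EuclideanSpace.real_norm_sq_eq]
  refine Finset.sum_congr rfl fun i _ => ?_
  rw [← inner_gradient_eq_fderiv, EuclideanSpace.inner_single_right]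
  simp

lemma fderiv_comp_toLp {n : ℕ} {w : EuclideanSpace ℝ (Fin n) → ℝ} (hw : ContDiff ℝ 1 w)
    (x : Fin n → ℝ) (i : Fin n) :
    fderiv ℝ (fun y : Fin n → ℝ => w (WithLp.toLp 2 y)) x (Pi.single i 1) =
      fderiv ℝ w (WithLp.toLp 2 x) (EuclideanSpace.single i 1) := by
  have h1 := (hw.differentiable one_ne_zero (WithLp.toLp 2 x)).hasFDerivAt
  have h2 : HasFDerivAt (fun y : Fin n → ℝ => WithLp.toLp 2 y)
      ((EuclideanSpace.equiv (Fin n) ℝ).symm : (Fin n → ℝ) →L[ℝ] EuclideanSpace ℝ (Fin n)) x :=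
    ((EuclideanSpace.equiv (Fin n) ℝ).symm : (Fin n → ℝ) →L[ℝ] EuclideanSpace ℝ (Fin n)).hasFDerivAt
  have h3 := (h1.comp x h2).fderiv
  change fderiv ℝ (w ∘ fun y : Fin n → ℝ => WithLp.toLp 2 y) x (Pi.single i 1) = _
  rw [h3]
  rfl

lemma setIntegral_ball_eq_setIntegral_symBox {n : ℕ} {F : EuclideanSpace ℝ (Fin n) → ℝ}
    (hF : ∀ x ∉ Metric.ball (0 : EuclideanSpace ℝ (Fin n)) (1 / 2), F x = 0) :
    ∫ x in Metric.ball (0 : EuclideanSpace ℝ (Fin n)) (1 / 2), F x =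
      ∫ x in symBox n (1 / 2), F (WithLp.toLp 2 x) := by
  rw [setIntegral_eq_integral_of_forall_compl_eq_zero hF,
    setIntegral_eq_integral_of_forall_compl_eq_zero]
  · exact ((PiLp.volume_preserving_toLp (Fin n)).integral_comp
      (MeasurableEquiv.toLp 2 (Fin n → ℝ)).measurableEmbedding F).symm
  · intro x hx
    refine hF _ fun hb => hx (mem_symBox.2 fun i => ?_)
    rw [mem_ball_zero_iff] at hb
    have := PiLp.norm_apply_le (WithLp.toLp 2 x) i
    rw [norm_eq_abs] at this
    simp only at this
    linarith

/-- The sharp Sobolev inequality for functions supported in the ball of radius `1 / 2`. -/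
theorem sobolev_ball {n : ℕ} (hn : 3 ≤ n) {w : EuclideanSpace ℝ (Fin n) → ℝ}
    (hw : ContDiff ℝ 1 w)
    (hw0 : tsupport w ⊆ Metric.ball (0 : EuclideanSpace ℝ (Fin n)) (1 / 2)) :
    sobolevConst n * (∫ x in Metric.ball (0 : EuclideanSpace ℝ (Fin n)) (1 / 2),
        (w x ^ 2) ^ ((n : ℝ) / (n - 2))) ^ (((n : ℝ) - 2) / n) ≤
      ∫ x in Metric.ball (0 : EuclideanSpace ℝ (Fin n)) (1 / 2), ‖gradient w x‖ ^ 2 := by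
  have hN : (3 : ℝ) ≤ n := by exact_mod_cast hn
  have hN2 : 0 < (n : ℝ) - 2 := by linarith
  have hz : ∀ x ∉ Metric.ball (0 : EuclideanSpace ℝ (Fin n)) (1 / 2), w x = 0 := fun x hx =>
    image_eq_zero_of_notMem_tsupport fun h => hx (hw0 h)
  have hz' : ∀ x ∉ Metric.ball (0 : EuclideanSpace ℝ (Fin n)) (1 / 2), fderiv ℝ w x = 0 :=
    fun x hx => Function.notMem_support.1 fun h => hx (hw0 (support_fderiv_subset ℝ h))
  rw [setIntegral_ball_eq_setIntegral_symBox, setIntegral_ball_eq_setIntegral_symBox]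
  · have h := sobolev_symBox hn (w := fun y : Fin n → ℝ => w (WithLp.toLp 2 y))
      (hw.comp (EuclideanSpace.equiv (Fin n) ℝ).symm.contDiff) ?_
    · simpa only [fderiv_comp_toLp hw, norm_gradient_sq_eq_sum] using h
    · intro x _ i hi
      refine hz _ fun hb => ?_
      rw [mem_ball_zero_iff] at hb
      have := PiLp.norm_apply_le (WithLp.toLp 2 x) i
      rw [norm_eq_abs] at this
      simp only at this
      linarith
  · intro x hx
    rw [norm_gradient_sq_eq_sum, hz' x hx]
    simp
  · intro x hx
    rw [hz x hx]
    simp [zero_rpow (div_pos (by linarith : (0 : ℝ) < n) hN2).ne']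

lemma integral_sphere_prod {n : ℕ} (hn : 0 < n) {F : EuclideanSpace ℝ (Fin n) → ℝ}
    (hF : Integrable F) :
    Integrable (fun ω : Metric.sphere (0 : EuclideanSpace ℝ (Fin n)) 1 =>
      ∫ r in Set.Ioi (0 : ℝ), r ^ (n - 1) * F (r • (ω : EuclideanSpace ℝ (Fin n))))
      (volume : Measure (EuclideanSpace ℝ (Fin n))).toSphere ∧
    ∫ x, F x = ∫ ω : Metric.sphere (0 : EuclideanSpace ℝ (Fin n)) 1,
      (∫ r in Set.Ioi (0 : ℝ), r ^ (n - 1) * F (r • (ω : EuclideanSpace ℝ (Fin n))))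
      ∂(volume : Measure (EuclideanSpace ℝ (Fin n))).toSphere := by
  have : Nontrivial (EuclideanSpace ℝ (Fin n)) := by
    have : Nonempty (Fin n) := ⟨⟨0, hn⟩⟩
    infer_instance
  have hdim : Module.finrank ℝ (EuclideanSpace ℝ (Fin n)) = n := by simp
  set μ : Measure (EuclideanSpace ℝ (Fin n)) := volume
  have hmp := μ.measurePreserving_homeomorphUnitSphereProd
  rw [hdim] at hmp
  have hemb := (homeomorphUnitSphereProd (EuclideanSpace ℝ (Fin n))).measurableEmbedding
  set G : Metric.sphere (0 : EuclideanSpace ℝ (Fin n)) 1 × Set.Ioi (0 : ℝ) → ℝ :=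
    fun p => F ((p.2 : ℝ) • (p.1 : EuclideanSpace ℝ (Fin n))) with hG
  have hcomp : ∀ x : ({(0)}ᶜ : Set (EuclideanSpace ℝ (Fin n))),
      G (homeomorphUnitSphereProd _ x) = F x := by
    intro x
    rw [hG]
    simp only
    congr 1
    have hx : (x : EuclideanSpace ℝ (Fin n)) ≠ 0 := x.2
    simp [smul_smul, norm_ne_zero_iff.2 hx]
  have h1 : Integrable (fun x : ({(0)}ᶜ : Set (EuclideanSpace ℝ (Fin n))) => F x)
      (μ.comap (↑)) := by
    have := (integrableOn_iff_comap_subtypeVal (μ := μ) (f := F)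
      (measurableSet_singleton (0 : EuclideanSpace ℝ (Fin n))).compl).1 hF.integrableOn
    exact this
  have h2 : Integrable G (μ.toSphere.prod (Measure.volumeIoiPow (n - 1))) := by
    rw [← hmp.integrable_comp_emb hemb]
    exact h1.congr (Filter.Eventually.of_forall fun x => (hcomp x).symm)
  have h3 : ∫ x, F x ∂μ = ∫ p, G p ∂(μ.toSphere.prod (Measure.volumeIoiPow (n - 1))) := by
    rw [← hmp.integral_comp hemb]
    simp only [hcomp]
    rw [integral_subtype_comap (measurableSet_singleton _).compl fun x => F x,
      restrict_compl_singleton]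
  have h4 : ∀ ω : Metric.sphere (0 : EuclideanSpace ℝ (Fin n)) 1,
      ∫ r, G (ω, r) ∂(Measure.volumeIoiPow (n - 1)) =
        ∫ r in Set.Ioi (0 : ℝ), r ^ (n - 1) * F (r • (ω : EuclideanSpace ℝ (Fin n))) := by
    intro ω
    simp only [Measure.volumeIoiPow, ENNReal.ofReal]
    rw [integral_withDensity_eq_integral_smul,
      integral_subtype_comap measurableSet_Ioi fun a : ℝ => Real.toNNReal (a ^ (n - 1)) •
        F (a • (ω : EuclideanSpace ℝ (Fin n))),
      setIntegral_congr_fun measurableSet_Ioi fun x hx => ?_]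
    · simp only [NNReal.smul_def, smul_eq_mul]
      rw [Real.coe_toNNReal _ (pow_nonneg (le_of_lt hx) _)]
    · exact (measurable_subtype_coe.pow_const _).real_toNNReal
  refine ⟨?_, ?_⟩
  · simpa only [h4] using h2.integral_prod_left
  · rw [h3, integral_prod _ h2]
    simp only [h4]

lemma integral_sphere_prod_ball {n : ℕ} (hn : 0 < n) {F : EuclideanSpace ℝ (Fin n) → ℝ}
    {R : ℝ} (hF : IntegrableOn F (Metric.ball 0 R)) :
    Integrable (fun ω : Metric.sphere (0 : EuclideanSpace ℝ (Fin n)) 1 =>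
      ∫ r in Set.Ioo (0 : ℝ) R, r ^ (n - 1) * F (r • (ω : EuclideanSpace ℝ (Fin n))))
      (volume : Measure (EuclideanSpace ℝ (Fin n))).toSphere ∧
    ∫ x in Metric.ball 0 R, F x = ∫ ω : Metric.sphere (0 : EuclideanSpace ℝ (Fin n)) 1,
      (∫ r in Set.Ioo (0 : ℝ) R, r ^ (n - 1) * F (r • (ω : EuclideanSpace ℝ (Fin n))))
      ∂(volume : Measure (EuclideanSpace ℝ (Fin n))).toSphere := by
  have h := integral_sphere_prod hn ((integrable_indicator_iff measurableSet_ball).2 hF)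
  rw [integral_indicator measurableSet_ball] at h
  have h1 : ∀ ω : Metric.sphere (0 : EuclideanSpace ℝ (Fin n)) 1,
      ∫ r in Set.Ioi (0 : ℝ), r ^ (n - 1) * (Metric.ball 0 R).indicator F
        (r • (ω : EuclideanSpace ℝ (Fin n))) =
      ∫ r in Set.Ioo (0 : ℝ) R, r ^ (n - 1) * F (r • (ω : EuclideanSpace ℝ (Fin n))) := by
    intro ω
    have hω : ‖(ω : EuclideanSpace ℝ (Fin n))‖ = 1 := by simp
    rw [← integral_indicator measurableSet_Ioi, ← integral_indicator measurableSet_Ioo]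
    congr 1
    ext r
    by_cases hr : 0 < r
    · by_cases hR : r < R <;>
        simp [Set.indicator, hr, hR, norm_smul, abs_of_pos hr]
    · simp [Set.indicator, hr]
  simpa only [h1] using h

/-- Comparison of integrals over two balls by comparing them along every ray. -/
lemma setIntegral_ball_le_of_rays {n : ℕ} (hn : 0 < n) {F G : EuclideanSpace ℝ (Fin n) → ℝ}
    {R R' : ℝ} (hF : IntegrableOn F (Metric.ball 0 R)) (hG : IntegrableOn G (Metric.ball 0 R'))
    (h : ∀ ω : EuclideanSpace ℝ (Fin n), ‖ω‖ = 1 →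
      ∫ r in Set.Ioo (0 : ℝ) R, r ^ (n - 1) * F (r • ω) ≤
        ∫ r in Set.Ioo (0 : ℝ) R', r ^ (n - 1) * G (r • ω)) :
    ∫ x in Metric.ball 0 R, F x ≤ ∫ x in Metric.ball 0 R', G x := by
  obtain ⟨i1, e1⟩ := integral_sphere_prod_ball hn hF
  obtain ⟨i2, e2⟩ := integral_sphere_prod_ball hn hG
  rw [e1, e2]
  exact integral_mono i1 i2 fun ω => h ω (by simp)

/-- The product `X_1(a,s) ⋯ X_i(a,s)`. -/
noncomputable def XProd (a : ℝ) (i : ℕ) (s : ℝ) : ℝ := ∏ j ∈ Finset.Icc 1 i, Xiter a j s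

lemma XProd_zero (a s : ℝ) : XProd a 0 s = 1 := by simp [XProd]

lemma XProd_succ (a : ℝ) (i : ℕ) (s : ℝ) :
    XProd a (i + 1) s = XProd a i s * Xiter a (i + 1) s :=
  Finset.prod_Icc_succ_top (by omega) _

lemma Xiter_succ (a : ℝ) (i : ℕ) (s : ℝ) : Xiter a (i + 1) s = X1 a (Xiter a i s) := rfl

/-- The numbers `X_0(a,s), …, X_m(a,s)` are all positive. -/
def XPos (a : ℝ) (m : ℕ) (s : ℝ) : Prop := ∀ j ≤ m, 0 < Xiter a j s

lemma XPos.pos {a s : ℝ} {m : ℕ} (h : XPos a m s) : 0 < s := h 0 (Nat.zero_le _)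

lemma XPos.mono {a s : ℝ} {m i : ℕ} (h : XPos a m s) (hi : i ≤ m) : XPos a i s :=
  fun j hj => h j (hj.trans hi)

lemma XPos.XProd_pos {a s : ℝ} {m : ℕ} (h : XPos a m s) {i : ℕ} (hi : i ≤ m) :
    0 < XProd a i s :=
  Finset.prod_pos fun j hj => h j ((Finset.mem_Icc.1 hj).2.trans hi)

lemma XPos.sub_log_pos {a s : ℝ} {m : ℕ} (h : XPos a (m + 1) s) :
    0 < a - log (Xiter a m s) := by
  have := h (m + 1) le_rfl
  rwa [Xiter_succ, X1, inv_pos] at this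

lemma hasDerivAt_X1 {a s : ℝ} (hs : 0 < s) (h : 0 < a - log s) :
    HasDerivAt (X1 a) (X1 a s ^ 2 / s) s := by
  have h1 := ((hasDerivAt_log hs.ne').const_sub a).fun_inv h.ne'
  have h2 : -(-s⁻¹) / (a - log s) ^ 2 = X1 a s ^ 2 / s := by
    rw [X1]; field_simp
  rw [h2] at h1
  exact h1

lemma hasDerivAt_Xiter {a s : ℝ} {i : ℕ} (h : XPos a i s) :
    HasDerivAt (Xiter a i) (Xiter a i s * XProd a i s / s) s := by
  induction i with
  | zero =>
    have hs := h.pos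
    have : Xiter a 0 s * XProd a 0 s / s = 1 := by
      rw [XProd_zero]; simp [Xiter, hs.ne']
    rw [this]
    exact hasDerivAt_id s
  | succ i ih =>
    have h0 := h.mono (Nat.le_succ i)
    have hi := h i (Nat.le_succ i)
    have h1 := (hasDerivAt_X1 hi h.sub_log_pos).comp s (ih h0)
    have h2 : X1 a (Xiter a i s) ^ 2 / Xiter a i s * (Xiter a i s * XProd a i s / s) =
        Xiter a (i + 1) s * XProd a (i + 1) s / s := by
      rw [XProd_succ, ← Xiter_succ]
      field_simp
    rw [h2] at h1
    exact h1

lemma hasDerivAt_XProd {a s : ℝ} {i : ℕ} (h : XPos a i s) :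
    HasDerivAt (XProd a i) (XProd a i s * (∑ j ∈ Finset.Icc 1 i, XProd a j s) / s) s := by
  induction i with
  | zero =>
    have : XProd a 0 = fun _ => 1 := funext (XProd_zero a)
    rw [this]
    simpa using hasDerivAt_const s (1 : ℝ)
  | succ i ih =>
    have h1 := (ih (h.mono (Nat.le_succ i))).mul (hasDerivAt_Xiter h)
    have h2 : XProd a i s * (∑ j ∈ Finset.Icc 1 i, XProd a j s) / s * Xiter a (i + 1) s +
        XProd a i s * (Xiter a (i + 1) s * XProd a (i + 1) s / s) =
        XProd a (i + 1) s * (∑ j ∈ Finset.Icc 1 (i + 1), XProd a j s) / s := by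
      rw [Finset.sum_Icc_succ_top (by omega), XProd_succ]
      ring
    rw [h2] at h1
    have h3 : XProd a (i + 1) = XProd a i * Xiter a (i + 1) := funext (XProd_succ a i)
    rwa [← h3] at h1

lemma contDiffAt_Xiter {a s : ℝ} {i : ℕ} (h : XPos a i s) : ContDiffAt ℝ 1 (Xiter a i) s := by
  induction i with
  | zero => exact contDiffAt_id
  | succ i ih =>
    exact ((contDiffAt_const).sub ((ih (h.mono (Nat.le_succ i))).log
      (h i (Nat.le_succ i)).ne')).inv h.sub_log_pos.ne'

lemma contDiffAt_XProd {a s : ℝ} {i : ℕ} (h : XPos a i s) : ContDiffAt ℝ 1 (XProd a i) s :=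
  contDiffAt_prod fun _ hj => contDiffAt_Xiter (h.mono (Finset.mem_Icc.1 hj).2)

lemma X1_le_X1 {a s t : ℝ} (hs : 0 < s) (hst : s ≤ t) (ht : 0 < a - log t) :
    X1 a s ≤ X1 a t := by
  have := log_le_log hs hst
  exact inv_anti₀ ht (by linarith)

lemma Xiter_le_Xiter {a s t : ℝ} {i : ℕ} (hs : XPos a i s) (ht : XPos a i t) (hst : s ≤ t) :
    Xiter a i s ≤ Xiter a i t := by
  induction i with
  | zero => exact hst
  | succ i ih =>
    exact X1_le_X1 (hs i (Nat.le_succ i))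
      (ih (hs.mono (Nat.le_succ i)) (ht.mono (Nat.le_succ i))) ht.sub_log_pos

lemma XProd_le_XProd {a s t : ℝ} {i : ℕ} (hs : XPos a i s) (ht : XPos a i t) (hst : s ≤ t) :
    XProd a i s ≤ XProd a i t :=
  Finset.prod_le_prod (fun j hj => (hs j (Finset.mem_Icc.1 hj).2).le) fun _ hj =>
    Xiter_le_Xiter (hs.mono (Finset.mem_Icc.1 hj).2) (ht.mono (Finset.mem_Icc.1 hj).2) hst

/-- The inverse function of `X_1(a, ·)`. -/
noncomputable def X1Inv (a t : ℝ) : ℝ := exp (a - t⁻¹)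

lemma X1_X1Inv (a t : ℝ) : X1 a (X1Inv a t) = t := by
  simp [X1, X1Inv]

lemma X1Inv_X1 {a s : ℝ} (hs : 0 < s) : X1Inv a (X1 a s) = s := by
  simp [X1, X1Inv, exp_log hs]

/-- The inverse function of `X_m(a, ·)`. -/
noncomputable def XiterInv (a : ℝ) : ℕ → ℝ → ℝ
  | 0, t => t
  | (m + 1), t => X1Inv a (XiterInv a m t)

lemma XiterInv_pos {a t : ℝ} (ht : 0 < t) : ∀ m, 0 < XiterInv a m t
  | 0 => ht
  | (_ + 1) => exp_pos _

lemma Xiter_succ' (a s : ℝ) (i : ℕ) : Xiter a (i + 1) s = Xiter a i (X1 a s) := by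
  induction i with
  | zero => rfl
  | succ i ih => rw [Xiter_succ, ih, Xiter_succ]

lemma XProd_succ' (a s : ℝ) (i : ℕ) : XProd a (i + 1) s = X1 a s * XProd a i (X1 a s) := by
  induction i with
  | zero => rw [XProd_succ, XProd_zero, XProd_zero, Xiter_succ', mul_comm]; rfl
  | succ i ih => rw [XProd_succ, ih, XProd_succ a i, Xiter_succ', mul_assoc]

lemma Xiter_XiterInv_succ (a t : ℝ) (i m : ℕ) :
    Xiter a (i + 1) (XiterInv a (m + 1) t) = Xiter a i (XiterInv a m t) := by
  rw [Xiter_succ', XiterInv, X1_X1Inv]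

lemma Xiter_XiterInv (a t : ℝ) (m : ℕ) : Xiter a m (XiterInv a m t) = t := by
  induction m with
  | zero => rfl
  | succ m ih => rw [Xiter_XiterInv_succ, ih]

lemma XiterInv_Xiter {a s : ℝ} {m : ℕ} (h : XPos a m s) : XiterInv a m (Xiter a m s) = s := by
  induction m generalizing s with
  | zero => rfl
  | succ m ih =>
    have h1 : XPos a m (X1 a s) := fun j hj => by
      rw [← Xiter_succ']
      exact h (j + 1) (by omega)
    rw [Xiter_succ', XiterInv, ih h1, X1Inv_X1 h.pos]

lemma XPos_XiterInv {a t : ℝ} (ht : 0 < t) (m : ℕ) : XPos a m (XiterInv a m t) := by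
  induction m with
  | zero =>
    intro j hj
    rw [Nat.le_zero.1 hj]
    exact ht
  | succ m ih =>
    intro j hj
    cases j with
    | zero => exact XiterInv_pos ht _
    | succ j =>
      rw [Xiter_XiterInv_succ]
      exact ih j (by omega)

lemma hasDerivAt_XiterInv {a t : ℝ} (ht : 0 < t) (m : ℕ) :
    HasDerivAt (XiterInv a m) (XiterInv a m t / (t * XProd a m (XiterInv a m t))) t := by
  induction m with
  | zero =>
    have : XiterInv a 0 t / (t * XProd a 0 (XiterInv a 0 t)) = 1 := by
      rw [XProd_zero]; simp [XiterInv, ht.ne']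
    rw [this]
    exact hasDerivAt_id t
  | succ m ih =>
    have hm := XiterInv_pos (a := a) ht m
    have hp : XProd a (m + 1) (XiterInv a (m + 1) t) =
        XiterInv a m t * XProd a m (XiterInv a m t) := by
      rw [XProd_succ', XiterInv, X1_X1Inv]
    have hpos := (XPos_XiterInv (a := a) ht m).XProd_pos le_rfl
    have h1 := ((ih.fun_inv hm.ne').const_sub a).exp
    have h2 : exp (a - (XiterInv a m t)⁻¹) *
        -(-(XiterInv a m t / (t * XProd a m (XiterInv a m t))) / XiterInv a m t ^ 2) =
        XiterInv a (m + 1) t / (t * XProd a (m + 1) (XiterInv a (m + 1) t)) := by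
      rw [hp]
      have : XiterInv a (m + 1) t = exp (a - (XiterInv a m t)⁻¹) := rfl
      rw [this]
      field_simp
    rw [h2] at h1
    exact h1

lemma contDiffAt_XiterInv {a t : ℝ} (ht : 0 < t) (m : ℕ) :
    ContDiffAt ℝ 1 (XiterInv a m) t := by
  induction m with
  | zero => exact contDiffAt_id
  | succ m ih =>
    exact (contDiffAt_const.sub (ih.inv (XiterInv_pos ht m).ne')).exp

lemma XiterInv_lt_XiterInv {a s t : ℝ} (hs : 0 < s) (hst : s < t) (m : ℕ) :
    XiterInv a m s < XiterInv a m t := by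
  induction m with
  | zero => exact hst
  | succ m ih =>
    refine exp_lt_exp.2 (sub_lt_sub_left ?_ a)
    exact inv_strictAnti₀ (XiterInv_pos hs m) ih

lemma tendsto_XiterInv (a : ℝ) (m : ℕ) :
    Filter.Tendsto (XiterInv a m) (nhdsWithin 0 (Set.Ioi 0)) (nhdsWithin 0 (Set.Ioi 0)) := by
  induction m with
  | zero => exact Filter.tendsto_id
  | succ m ih =>
    refine tendsto_nhdsWithin_iff.2 ⟨?_, Filter.Eventually.of_forall fun t => exp_pos _⟩
    have h1 := Filter.tendsto_neg_atTop_atBot.comp (tendsto_inv_nhdsGT_zero.comp ih)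
    exact tendsto_exp_atBot.comp (Filter.tendsto_atBot_add_const_left _ a h1)

/-- The function `y ↦ u (ψ(|y|) y / |y|) κ(|y|)`. -/
noncomputable def radialTransform {n : ℕ} (ψ κ : ℝ → ℝ) (u : EuclideanSpace ℝ (Fin n) → ℝ)
    (y : EuclideanSpace ℝ (Fin n)) : ℝ :=
  u ((ψ ‖y‖ / ‖y‖) • y) * κ ‖y‖

lemma hasFDerivAt_norm_of_ne_zero {n : ℕ} {y : EuclideanSpace ℝ (Fin n)} (hy : y ≠ 0) :
    HasFDerivAt (fun x : EuclideanSpace ℝ (Fin n) => ‖x‖) (‖y‖⁻¹ • innerSL ℝ y) y := by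
  have hy' : ‖y‖ ≠ 0 := norm_ne_zero_iff.2 hy
  have h1 := ((hasStrictFDerivAt_norm_sq y).hasFDerivAt).sqrt (pow_ne_zero 2 hy')
  simp only [sqrt_sq (norm_nonneg _)] at h1
  refine h1.congr_fderiv ?_
  rw [← Nat.cast_smul_eq_nsmul ℝ, smul_smul]
  congr 1
  push_cast
  field_simp

lemma radialTransform_smul {n : ℕ} {ψ κ : ℝ → ℝ} {u : EuclideanSpace ℝ (Fin n) → ℝ}
    {ω : EuclideanSpace ℝ (Fin n)} (hω : ‖ω‖ = 1) {ρ : ℝ} (hρ : 0 < ρ) :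
    radialTransform ψ κ u (ρ • ω) = u (ψ ρ • ω) * κ ρ := by
  have h1 : ‖ρ • ω‖ = ρ := by rw [norm_smul, hω, norm_of_nonneg hρ.le, mul_one]
  rw [radialTransform, h1, smul_smul, div_mul_cancel₀ _ hρ.ne']

lemma hasGradientAt_radialTransform {n : ℕ} {ψ κ : ℝ → ℝ} {u : EuclideanSpace ℝ (Fin n) → ℝ}
    (hu : ContDiff ℝ 1 u) {ω : EuclideanSpace ℝ (Fin n)} (hω : ‖ω‖ = 1) {ρ ψ' κ' : ℝ}
    (hρ : 0 < ρ) (hψ : HasDerivAt ψ ψ' ρ) (hκ : HasDerivAt κ κ' ρ) :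
    HasGradientAt (radialTransform ψ κ u)
      ((κ ρ * (ψ ρ / ρ)) • gradient u (ψ ρ • ω) +
        (κ ρ * ((ψ' - ψ ρ / ρ) * inner ℝ (gradient u (ψ ρ • ω)) ω) + u (ψ ρ • ω) * κ') • ω)
      (ρ • ω) := by
  have hn : ‖ρ • ω‖ = ρ := by rw [norm_smul, hω, norm_of_nonneg hρ.le, mul_one]
  have h0 : ρ • ω ≠ 0 := by
    rw [← norm_ne_zero_iff, hn]; exact hρ.ne'
  have h1 := hasFDerivAt_norm_of_ne_zero h0
  rw [hn] at h1
  have h2 : HasFDerivAt (fun y : EuclideanSpace ℝ (Fin n) => ψ ‖y‖)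
      (ψ' • (ρ⁻¹ • innerSL ℝ (ρ • ω))) (ρ • ω) :=
    HasDerivAt.comp_hasFDerivAt (ρ • ω) (by rwa [hn]) h1
  have h3 : HasFDerivAt (fun y : EuclideanSpace ℝ (Fin n) => κ ‖y‖)
      (κ' • (ρ⁻¹ • innerSL ℝ (ρ • ω))) (ρ • ω) :=
    HasDerivAt.comp_hasFDerivAt (ρ • ω) (by rwa [hn]) h1
  have h4 : HasFDerivAt (fun y : EuclideanSpace ℝ (Fin n) => ψ ‖y‖ / ‖y‖)
      (((ψ' * ρ - ψ ρ * 1) / ρ ^ 2) • (ρ⁻¹ • innerSL ℝ (ρ • ω))) (ρ • ω) :=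
    HasDerivAt.comp_hasFDerivAt (h₂ := fun t => ψ t / t) (ρ • ω)
      (by rw [hn]; exact hψ.fun_div (hasDerivAt_id ρ) hρ.ne') h1
  have h5 : HasFDerivAt (fun y : EuclideanSpace ℝ (Fin n) => (ψ ‖y‖ / ‖y‖) • y) _ (ρ • ω) :=
    h4.fun_smul (hasFDerivAt_id (ρ • ω))
  have h6 : (ψ ‖ρ • ω‖ / ‖ρ • ω‖) • (ρ • ω) = ψ ρ • ω := by
    rw [hn, smul_smul, div_mul_cancel₀ _ hρ.ne']
  have h7 : HasFDerivAt u (fderiv ℝ u (ψ ρ • ω)) ((ψ ‖ρ • ω‖ / ‖ρ • ω‖) • (ρ • ω)) := by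
    rw [h6]
    exact (hu.differentiable one_ne_zero _).hasFDerivAt
  have h8 := (HasFDerivAt.comp
    (f := fun y : EuclideanSpace ℝ (Fin n) => (ψ ‖y‖ / ‖y‖) • y) (ρ • ω) h7 h5).fun_mul h3
  rw [hasGradientAt_iff_hasFDerivAt]
  refine h8.congr_fderiv ?_
  ext v
  have h9 : fderiv ℝ u (ψ ρ • ω) = (innerSL ℝ (gradient u (ψ ρ • ω))) := by
    ext v
    rw [← inner_gradient_eq_fderiv]
    rfl
  rw [Function.comp_apply, h6, h9]
  simp [hn]
  field_simp
  ring

lemma norm_gradient_radialTransform_sq {n : ℕ} {ψ κ : ℝ → ℝ}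
    {u : EuclideanSpace ℝ (Fin n) → ℝ}
    (hu : ContDiff ℝ 1 u) {ω : EuclideanSpace ℝ (Fin n)} (hω : ‖ω‖ = 1) {ρ ψ' κ' : ℝ}
    (hρ : 0 < ρ) (hψ : HasDerivAt ψ ψ' ρ) (hκ : HasDerivAt κ κ' ρ) :
    ‖gradient (radialTransform ψ κ u) (ρ • ω)‖ ^ 2 =
      (κ ρ * (ψ ρ / ρ)) ^ 2 * (‖gradient u (ψ ρ • ω)‖ ^ 2 -
        (inner ℝ (gradient u (ψ ρ • ω)) ω) ^ 2) +
      (κ ρ * ψ' * inner ℝ (gradient u (ψ ρ • ω)) ω + u (ψ ρ • ω) * κ') ^ 2 := by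
  rw [(hasGradientAt_radialTransform hu hω hρ hψ hκ).gradient, norm_add_sq_real, norm_smul,
    norm_smul, hω, inner_smul_left, inner_smul_right, mul_pow, mul_pow, norm_eq_abs, norm_eq_abs,
    sq_abs, sq_abs]
  simp only [conj_trivial]
  ring

/-- The solution `r` of `X_{k+1}(a,r) = X_{k+1}(a,1) (2ρ)^ν`. -/
noncomputable def radialChange (a : ℝ) (k ν : ℕ) (ρ : ℝ) : ℝ :=
  XiterInv a (k + 1) (Xiter a (k + 1) 1 * 2 ^ ν * ρ ^ ν)

/-- The weight `(r^ν X_1(a,r) ⋯ X_k(a,r))^{1/2}` at `r = radialChange a k ν ρ`. -/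
noncomputable def radialWeight (a : ℝ) (k ν : ℕ) (ρ : ℝ) : ℝ :=
  if 0 < ρ then sqrt (radialChange a k ν ρ ^ ν * XProd a k (radialChange a k ν ρ)) else 0

/-- The logarithmic derivative with respect to `log r` of `(r^ν X_1(a,r) ⋯ X_k(a,r))^{-1/2}`. -/
noncomputable def hardyExponent (a : ℝ) (k ν : ℕ) (r : ℝ) : ℝ :=
  -((ν : ℝ) + ∑ j ∈ Finset.Icc 1 k, XProd a j r) / 2

section

variable {a : ℝ} {k ν : ℕ} {ρ : ℝ}

lemma XPos_radialChange (hc : 0 < Xiter a (k + 1) 1) (hρ : 0 < ρ) :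
    XPos a (k + 1) (radialChange a k ν ρ) :=
  XPos_XiterInv (by positivity) _

lemma radialChange_pos (hc : 0 < Xiter a (k + 1) 1) (hρ : 0 < ρ) :
    0 < radialChange a k ν ρ :=
  (XPos_radialChange hc hρ).pos

lemma Xiter_radialChange (a : ℝ) (k ν : ℕ) (ρ : ℝ) :
    Xiter a (k + 1) (radialChange a k ν ρ) = Xiter a (k + 1) 1 * 2 ^ ν * ρ ^ ν :=
  Xiter_XiterInv _ _ _

lemma radialChange_half (h : XPos a (k + 1) 1) : radialChange a k ν (1 / 2) = 1 := by
  rw [radialChange, mul_assoc, ← mul_pow]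
  norm_num
  exact XiterInv_Xiter h

lemma radialChange_lt (hν : ν ≠ 0) (hc : 0 < Xiter a (k + 1) 1) {σ : ℝ} (hρ : 0 < ρ)
    (h : ρ < σ) : radialChange a k ν ρ < radialChange a k ν σ :=
  XiterInv_lt_XiterInv (by positivity) (by gcongr) _

lemma hasDerivAt_radialChange (hν : ν ≠ 0) (hc : 0 < Xiter a (k + 1) 1) (hρ : 0 < ρ) :
    HasDerivAt (radialChange a k ν) (ν * radialChange a k ν ρ /
      (ρ * XProd a (k + 1) (radialChange a k ν ρ))) ρ := by
  have h1 := ((hasDerivAt_pow ν ρ).const_mul (Xiter a (k + 1) 1 * 2 ^ ν))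
  have h0 : 0 < Xiter a (k + 1) 1 * 2 ^ ν * ρ ^ ν := by positivity
  have h2 := (hasDerivAt_XiterInv (a := a) h0 (k + 1)).comp ρ h1
  have h3 := (XPos_radialChange (ν := ν) hc hρ).XProd_pos le_rfl
  refine h2.congr_deriv ?_
  rw [radialChange] at h3 ⊢
  obtain ⟨m, rfl⟩ := Nat.exists_eq_succ_of_ne_zero hν
  simp only [Nat.succ_eq_add_one, Nat.add_sub_cancel] at *
  field_simp
  ring

lemma contDiffAt_radialChange (hc : 0 < Xiter a (k + 1) 1) (hρ : 0 < ρ) :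
    ContDiffAt ℝ 1 (radialChange a k ν) ρ :=
  (contDiffAt_XiterInv (t := Xiter a (k + 1) 1 * 2 ^ ν * ρ ^ ν) (by positivity) (k + 1)).comp ρ
    (contDiffAt_const.mul (contDiffAt_id.pow ν))

lemma radialWeight_of_pos (hρ : 0 < ρ) : radialWeight a k ν ρ =
    sqrt (radialChange a k ν ρ ^ ν * XProd a k (radialChange a k ν ρ)) :=
  if_pos hρ

lemma radialWeight_nonneg : 0 ≤ radialWeight a k ν ρ := by
  rw [radialWeight]
  split_ifs
  exacts [sqrt_nonneg _, le_rfl]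

lemma radialWeight_sq (hc : 0 < Xiter a (k + 1) 1) (hρ : 0 < ρ) : radialWeight a k ν ρ ^ 2 =
    radialChange a k ν ρ ^ ν * XProd a k (radialChange a k ν ρ) := by
  rw [radialWeight_of_pos hρ, sq_sqrt]
  have h1 := radialChange_pos (ν := ν) hc hρ
  have h2 := (XPos_radialChange (ν := ν) hc hρ).XProd_pos (Nat.le_succ k)
  positivity

lemma hasDerivAt_radialWeight (hν : ν ≠ 0) (hc : 0 < Xiter a (k + 1) 1) (hρ : 0 < ρ) :
    HasDerivAt (radialWeight a k ν) (-(hardyExponent a k ν (radialChange a k ν ρ) /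
      radialChange a k ν ρ) * (ν * radialChange a k ν ρ /
      (ρ * XProd a (k + 1) (radialChange a k ν ρ))) * radialWeight a k ν ρ) ρ := by
  have h1 := radialChange_pos (ν := ν) hc hρ
  have h2 := (XPos_radialChange (ν := ν) hc hρ).XProd_pos (Nat.le_succ k)
  have hsq := radialWeight_sq (ν := ν) hc hρ
  have h0 : (fun ρ => sqrt (radialChange a k ν ρ ^ ν * XProd a k (radialChange a k ν ρ)))
      =ᶠ[nhds ρ] radialWeight a k ν := by
    filter_upwards [Ioi_mem_nhds hρ] with t ht
    rw [radialWeight_of_pos ht]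
  have hψ := hasDerivAt_radialChange hν hc hρ
  have hX := (hasDerivAt_XProd ((XPos_radialChange (ν := ν) hc hρ).mono (Nat.le_succ k))).comp ρ hψ
  have hE := ((hψ.fun_pow ν).fun_mul hX).sqrt (by
    simp only [Function.comp_apply]; positivity)
  refine (HasDerivAt.congr_of_eventuallyEq hE h0.symm).congr_deriv ?_
  simp only [Function.comp_apply]
  rw [← radialWeight_of_pos hρ]
  have hpos : 0 < radialWeight a k ν ρ := by
    rw [radialWeight_of_pos hρ]; positivity
  rw [div_eq_iff (by positivity)]
  have : ∀ x y z : ℝ, x * y * z * (2 * z) = x * y * 2 * z ^ 2 := by intros; ring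
  rw [this, hsq, hardyExponent]
  obtain ⟨m, rfl⟩ := Nat.exists_eq_succ_of_ne_zero hν
  simp only [Nat.succ_eq_add_one, Nat.add_sub_cancel] at *
  field_simp
  ring

lemma contDiffAt_radialWeight (hc : 0 < Xiter a (k + 1) 1) (hρ : 0 < ρ) :
    ContDiffAt ℝ 1 (radialWeight a k ν) ρ := by
  have h1 := radialChange_pos (ν := ν) hc hρ
  have h2 := (XPos_radialChange (ν := ν) hc hρ).XProd_pos (Nat.le_succ k)
  have h0 : (fun ρ => sqrt (radialChange a k ν ρ ^ ν * XProd a k (radialChange a k ν ρ)))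
      =ᶠ[nhds ρ] radialWeight a k ν := by
    filter_upwards [Ioi_mem_nhds hρ] with t ht
    rw [radialWeight_of_pos ht]
  have hψ := contDiffAt_radialChange (ν := ν) hc hρ
  have hX := (contDiffAt_XProd ((XPos_radialChange (ν := ν) hc hρ).mono
    (Nat.le_succ k))).comp ρ hψ
  exact (((hψ.pow ν).mul hX).sqrt (by
    simp only [Function.comp_apply]; positivity)).congr_of_eventuallyEq h0.symm

lemma tendsto_radialChange (hν : ν ≠ 0) (hc : 0 < Xiter a (k + 1) 1) :
    Filter.Tendsto (radialChange a k ν) (nhdsWithin 0 (Set.Ioi 0)) (nhdsWithin 0 (Set.Ioi 0)) := by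
  refine (tendsto_XiterInv a (k + 1)).comp (tendsto_nhdsWithin_iff.2 ⟨?_, ?_⟩)
  · have : Continuous fun ρ : ℝ => Xiter a (k + 1) 1 * 2 ^ ν * ρ ^ ν := by fun_prop
    have h := this.tendsto 0
    simp only [zero_pow hν, mul_zero] at h
    exact h.mono_left nhdsWithin_le_nhds
  · filter_upwards [self_mem_nhdsWithin] with ρ hρ
    have : (0:ℝ) < ρ := hρ
    rw [Set.mem_Ioi]
    positivity

lemma injOn_radialChange (hν : ν ≠ 0) (hc : 0 < Xiter a (k + 1) 1) :
    Set.InjOn (radialChange a k ν) (Set.Ioo 0 (1 / 2)) :=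
  StrictMonoOn.injOn fun _ hx _ _ hxy => radialChange_lt hν hc hx.1 hxy

lemma image_radialChange (hν : ν ≠ 0) (h : ∀ s ∈ Set.Ioc (0 : ℝ) 1, XPos a (k + 1) s) :
    radialChange a k ν '' Set.Ioo 0 (1 / 2) = Set.Ioo 0 1 := by
  have h1 := h 1 (by norm_num)
  have hc := h1 (k + 1) le_rfl
  ext r
  constructor
  · rintro ⟨ρ, hρ, rfl⟩
    exact ⟨radialChange_pos hc hρ.1, (radialChange_lt hν hc hρ.1 hρ.2).trans_eq
      (radialChange_half h1)⟩
  · intro hr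
    have hX := h r ⟨hr.1, hr.2.le⟩
    have hXr := hX (k + 1) le_rfl
    set ρ : ℝ := (Xiter a (k + 1) r / (Xiter a (k + 1) 1 * 2 ^ ν)) ^ ((ν : ℝ)⁻¹)
    have hρ : 0 < ρ := by positivity
    have hψ : radialChange a k ν ρ = r := by
      rw [radialChange, rpow_inv_natCast_pow (by positivity) hν, mul_div_cancel₀ _ (by positivity)]
      exact XiterInv_Xiter hX
    refine ⟨ρ, ⟨hρ, ?_⟩, hψ⟩
    by_contra! hle
    rcases hle.lt_or_eq with h2 | h2
    · have := radialChange_lt (k := k) (a := a) hν hc (by norm_num) h2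
      rw [radialChange_half h1, hψ] at this
      exact absurd this hr.2.not_gt
    · rw [← h2, radialChange_half h1] at hψ
      exact hr.2.ne hψ.symm

end

/-- The function `f` is continuous and bounded on the interval `(0,1)`. -/
def ContBddUnit (f : ℝ → ℝ) : Prop :=
  ContinuousOn f (Set.Ioo 0 1) ∧ ∃ M, ∀ r ∈ Set.Ioo (0 : ℝ) 1, |f r| ≤ M

namespace ContBddUnit

variable {f g : ℝ → ℝ}

lemma of_continuous (hf : Continuous f) : ContBddUnit f := by
  refine ⟨hf.continuousOn, ?_⟩
  obtain ⟨M, hM⟩ := isCompact_Icc.exists_bound_of_continuousOn (hf.continuousOn (s := Set.Icc 0 1))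
  exact ⟨M, fun r hr => hM r ⟨hr.1.le, hr.2.le⟩⟩

lemma add (hf : ContBddUnit f) (hg : ContBddUnit g) : ContBddUnit (fun r => f r + g r) := by
  obtain ⟨hf, M, hM⟩ := hf
  obtain ⟨hg, N, hN⟩ := hg
  exact ⟨hf.add hg, M + N, fun r hr => (abs_add_le _ _).trans (add_le_add (hM r hr) (hN r hr))⟩

lemma mul (hf : ContBddUnit f) (hg : ContBddUnit g) : ContBddUnit (fun r => f r * g r) := by
  obtain ⟨hf, M, hM⟩ := hf
  obtain ⟨hg, N, hN⟩ := hg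
  refine ⟨hf.mul hg, M * N, fun r hr => ?_⟩
  rw [abs_mul]
  exact mul_le_mul (hM r hr) (hN r hr) (abs_nonneg _) ((abs_nonneg _).trans (hM r hr))

lemma const (c : ℝ) : ContBddUnit (fun _ => c) := of_continuous continuous_const

lemma sub (hf : ContBddUnit f) (hg : ContBddUnit g) : ContBddUnit (fun r => f r - g r) := by
  have := hf.add ((const (-1)).mul hg)
  simpa only [neg_one_mul, ← sub_eq_add_neg] using this

lemma sum {ι : Type*} (s : Finset ι) {F : ι → ℝ → ℝ} (h : ∀ i ∈ s, ContBddUnit (F i)) :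
    ContBddUnit (fun r => ∑ i ∈ s, F i r) := by
  classical
  induction s using Finset.induction_on with
  | empty => simpa using const 0
  | insert i s hi ih =>
    simp only [Finset.sum_insert hi]
    exact (h i (Finset.mem_insert_self i s)).add
      (ih fun j hj => h j (Finset.mem_insert_of_mem hj))

lemma congr (hf : ContBddUnit f) (h : ∀ r ∈ Set.Ioo (0 : ℝ) 1, g r = f r) : ContBddUnit g := by
  obtain ⟨hf, M, hM⟩ := hf
  exact ⟨hf.congr h, M, fun r hr => by rw [h r hr]; exact hM r hr⟩

lemma integrableOn (hf : ContBddUnit f) : IntegrableOn f (Set.Ioo 0 1) := by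
  obtain ⟨hf, M, hM⟩ := hf
  refine Integrable.of_bound (hf.aestronglyMeasurable measurableSet_Ioo) M ?_
  rw [ae_restrict_iff' measurableSet_Ioo]
  exact Filter.Eventually.of_forall fun r hr => hM r hr

lemma XProd {a : ℝ} {i : ℕ} (h : ∀ s ∈ Set.Ioc (0 : ℝ) 1, XPos a i s) :
    ContBddUnit (XProd a i) := by
  refine ⟨fun r hr => (contDiffAt_XProd
    (h r ⟨hr.1, hr.2.le⟩)).continuousAt.continuousWithinAt, _root_.XProd a i 1, fun r hr => ?_⟩
  have hr' := h r ⟨hr.1, hr.2.le⟩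
  rw [abs_of_pos (hr'.XProd_pos le_rfl)]
  exact XProd_le_XProd hr' (h 1 (by norm_num)) hr.2.le

end ContBddUnit

lemma two_mul_sum_mul_sum_Icc (f : ℕ → ℝ) (k : ℕ) :
    2 * ∑ i ∈ Finset.Icc 1 k, f i * ∑ j ∈ Finset.Icc 1 i, f j =
      (∑ i ∈ Finset.Icc 1 k, f i) ^ 2 + ∑ i ∈ Finset.Icc 1 k, f i ^ 2 := by
  induction k with
  | zero => simp
  | succ k ih =>
    simp only [Finset.sum_Icc_succ_top (Nat.le_add_left 1 k), mul_add, ih]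
    ring

/-- The numerator of the improved Hardy weight. -/
noncomputable def hardyWeight (a : ℝ) (k ν : ℕ) (r : ℝ) : ℝ :=
  (ν : ℝ) ^ 2 / 4 + (∑ i ∈ Finset.Icc 1 k, XProd a i r ^ 2) / 4

lemma hasDerivAt_hardyExponent {a r : ℝ} {k : ℕ} (ν : ℕ) (h : XPos a k r) :
    HasDerivAt (hardyExponent a k ν)
      (-(hardyExponent a k ν r ^ 2 + ν * hardyExponent a k ν r + hardyWeight a k ν r) / r) r := by
  have h1 : HasDerivAt (fun r => ∑ j ∈ Finset.Icc 1 k, XProd a j r)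
      (∑ j ∈ Finset.Icc 1 k, XProd a j r * (∑ i ∈ Finset.Icc 1 j, XProd a i r) / r) r :=
    HasDerivAt.fun_sum fun j hj => hasDerivAt_XProd (h.mono (Finset.mem_Icc.1 hj).2)
  refine (((h1.const_add (ν : ℝ)).fun_neg.div_const 2)).congr_deriv ?_
  rw [← Finset.sum_div]
  have h2 := two_mul_sum_mul_sum_Icc (fun j => XProd a j r) k
  have hr := h.pos
  rw [hardyExponent, hardyWeight]
  field_simp
  linear_combination (-4) * h2

section

variable {n k ν : ℕ} {a : ℝ} {u : EuclideanSpace ℝ (Fin n) → ℝ} {ω : EuclideanSpace ℝ (Fin n)}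

/-- The derivative of `r^ν h(r) u(r ω)^2`, where `h` is `hardyExponent a k ν`. -/
noncomputable def hardyBoundaryDeriv (a : ℝ) (k ν : ℕ) (u : EuclideanSpace ℝ (Fin n) → ℝ)
    (ω : EuclideanSpace ℝ (Fin n)) (r : ℝ) : ℝ :=
  -r ^ (ν - 1) * (hardyExponent a k ν r ^ 2 + hardyWeight a k ν r) * u (r • ω) ^ 2 +
    2 * r ^ ν * hardyExponent a k ν r * u (r • ω) * inner ℝ (gradient u (r • ω)) ω

lemma hasDerivAt_ray (hu : ContDiff ℝ 1 u) (r : ℝ) :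
    HasDerivAt (fun r : ℝ => u (r • ω)) (inner ℝ (gradient u (r • ω)) ω) r := by
  rw [inner_gradient_eq_fderiv]
  have h1 : HasDerivAt (fun r : ℝ => r • ω) ω r := by
    simpa using (hasDerivAt_id r).smul_const ω
  exact (hu.differentiable one_ne_zero (r • ω)).hasFDerivAt.comp_hasDerivAt r h1

lemma hasDerivAt_hardyBoundary (hν : ν ≠ 0) (hu : ContDiff ℝ 1 u) {r : ℝ} (h : XPos a k r) :
    HasDerivAt (fun r => r ^ ν * hardyExponent a k ν r * u (r • ω) ^ 2)
      (hardyBoundaryDeriv a k ν u ω r) r := by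
  have hr := h.pos
  refine (((hasDerivAt_pow ν r).fun_mul (hasDerivAt_hardyExponent ν h)).fun_mul
    ((hasDerivAt_ray hu r).fun_pow 2)).congr_deriv ?_
  obtain ⟨m, rfl⟩ := Nat.exists_eq_succ_of_ne_zero hν
  simp only [Nat.succ_eq_add_one, hardyBoundaryDeriv, Nat.add_sub_cancel] at *
  field_simp
  ring

lemma continuous_gradient (hu : ContDiff ℝ 1 u) : Continuous (gradient u) :=
  (InnerProductSpace.toDual ℝ _).symm.continuous.comp (hu.continuous_fderiv one_ne_zero)

lemma ContBddUnit.hardyExponent (h : ∀ s ∈ Set.Ioc (0 : ℝ) 1, XPos a k s) :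
    ContBddUnit (hardyExponent a k ν) := by
  have := (ContBddUnit.const (-1 / 2)).mul ((ContBddUnit.const (ν : ℝ)).add (ContBddUnit.sum
    (Finset.Icc 1 k) fun j hj => ContBddUnit.XProd fun s hs => (h s hs).mono
      (Finset.mem_Icc.1 hj).2))
  refine this.congr fun r _ => ?_
  rw [_root_.hardyExponent]
  ring

lemma ContBddUnit.hardyWeight (h : ∀ s ∈ Set.Ioc (0 : ℝ) 1, XPos a k s) :
    ContBddUnit (hardyWeight a k ν) := by
  have hX : ∀ j ∈ Finset.Icc 1 k, ContBddUnit (fun r => _root_.XProd a j r * _root_.XProd a j r) :=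
    fun j hj => by
      have := ContBddUnit.XProd fun s hs => (h s hs).mono (Finset.mem_Icc.1 hj).2
      exact this.mul this
  refine ((ContBddUnit.const ((ν : ℝ) ^ 2 / 4)).add ((ContBddUnit.const (1 / 4)).mul
    (ContBddUnit.sum (Finset.Icc 1 k) hX))).congr fun r _ => ?_
  simp only [_root_.hardyWeight, ← pow_two]
  ring

lemma ContBddUnit.hardyBoundaryDeriv (hu : ContDiff ℝ 1 u)
    (h : ∀ s ∈ Set.Ioc (0 : ℝ) 1, XPos a k s) :
    ContBddUnit (hardyBoundaryDeriv a k ν u ω) := by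
  have hω : Continuous fun r : ℝ => r • ω := by fun_prop
  have hU : Continuous fun r : ℝ => u (r • ω) := hu.continuous.comp hω
  have hp : Continuous fun r : ℝ => inner ℝ (gradient u (r • ω)) ω :=
    ((continuous_gradient hu).comp hω).inner continuous_const
  have hh := ContBddUnit.hardyExponent (ν := ν) h
  have h1 := (hh.mul hh).add (ContBddUnit.hardyWeight (ν := ν) h)
  have hc1 : Continuous fun r : ℝ => -r ^ (ν - 1) * u (r • ω) ^ 2 := by fun_prop
  have hc2 : Continuous fun r : ℝ => 2 * r ^ ν * u (r • ω) * inner ℝ (gradient u (r • ω)) ω := by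
    fun_prop
  refine ((h1.mul (of_continuous hc1)).add (hh.mul (of_continuous hc2))).congr fun r _ => ?_
  rw [_root_.hardyBoundaryDeriv]
  ring

lemma integral_hardyBoundaryDeriv (hν : ν ≠ 0) (hu : ContDiff ℝ 1 u)
    (hsupp : tsupport u ⊆ Metric.ball 0 1)
    (h : ∀ s ∈ Set.Ioc (0 : ℝ) 1, XPos a k s) (hω : ‖ω‖ = 1) :
    ∫ r in Set.Ioo 0 1, hardyBoundaryDeriv a k ν u ω r = 0 := by
  have h_int := (ContBddUnit.hardyBoundaryDeriv (ν := ν) (ω := ω) hu h).integrableOn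
  have hωc : Continuous fun r : ℝ => r • ω := by fun_prop
  have hU : Continuous fun r : ℝ => u (r • ω) ^ 2 := (hu.continuous.comp hωc).pow 2
  rw [← integral_Ioc_eq_integral_Ioo, ← intervalIntegral.integral_of_le zero_le_one,
    intervalIntegral.integral_eq_sub_of_hasDerivAt_of_tendsto zero_lt_one (fa := 0) (fb := 0)
      (fun r hr => hasDerivAt_hardyBoundary hν hu (h r ⟨hr.1, hr.2.le⟩)) ?_ ?_ ?_, sub_zero]
  · rwa [intervalIntegrable_iff_integrableOn_Ioo_of_le zero_le_one]
  · obtain ⟨-, M, hM⟩ := (ContBddUnit.hardyExponent (ν := ν) h).mul (ContBddUnit.of_continuous hU)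
    have h1 : Filter.Tendsto (fun r : ℝ => r ^ ν) (nhdsWithin 0 (Set.Ioi 0)) (nhds 0) := by
      have := (continuous_pow (M := ℝ) ν).tendsto 0
      rw [zero_pow hν] at this
      exact this.mono_left nhdsWithin_le_nhds
    have h2 : Filter.Tendsto (fun r : ℝ => M * r ^ ν) (nhdsWithin 0 (Set.Ioi 0)) (nhds 0) := by
      simpa using h1.const_mul M
    refine squeeze_zero_norm' ?_ h2
    filter_upwards [Ioo_mem_nhdsGT zero_lt_one] with r hr
    have := hM r hr
    rw [mul_assoc, norm_mul, norm_pow, norm_of_nonneg hr.1.le, mul_comm]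
    exact mul_le_mul_of_nonneg_right this (pow_nonneg hr.1.le _)
  · have h1 : ω ∉ tsupport u := fun hmem => by
      have := hsupp hmem
      simp [hω] at this
    have h2 := notMem_tsupport_iff_eventuallyEq.1 h1
    have h3 : Filter.Tendsto (fun r : ℝ => r • ω) (nhdsWithin 1 (Set.Iio 1)) (nhds ω) := by
      have := hωc.tendsto 1
      rw [one_smul] at this
      exact this.mono_left nhdsWithin_le_nhds
    refine tendsto_const_nhds.congr' ?_
    filter_upwards [h3.eventually h2] with r hr
    rw [hr]
    simp

end

section

variable {n k ν : ℕ} {a : ℝ} {u : EuclideanSpace ℝ (Fin n) → ℝ} {ω : EuclideanSpace ℝ (Fin n)}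

lemma inner_sq_le_norm_sq {E : Type*} [NormedAddCommGroup E] [InnerProductSpace ℝ E] (v : E)
    {ω : E} (hω : ‖ω‖ = 1) : inner ℝ v ω ^ 2 ≤ ‖v‖ ^ 2 := by
  have := abs_real_inner_le_norm v ω
  rw [hω, mul_one] at this
  rw [← sq_abs]
  gcongr

lemma norm_gradient_radialTransform_sq_le (hν : ν ≠ 0) (hc : 0 < Xiter a (k + 1) 1)
    (hu : ContDiff ℝ 1 u) (hω : ‖ω‖ = 1) {ρ : ℝ} (hρ : 0 < ρ)
    (hP : XProd a (k + 1) (radialChange a k ν ρ) ≤ ν) :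
    ρ ^ (ν + 1) * (Xiter a (k + 1) 1 * 2 ^ ν / ν *
      ‖gradient (radialTransform (radialChange a k ν) (radialWeight a k ν) u) (ρ • ω)‖ ^ 2) ≤
    (ν * radialChange a k ν ρ / (ρ * XProd a (k + 1) (radialChange a k ν ρ))) *
      (radialChange a k ν ρ ^ (ν + 1) * (‖gradient u (radialChange a k ν ρ • ω)‖ ^ 2 -
        hardyWeight a k ν (radialChange a k ν ρ) / radialChange a k ν ρ ^ 2 *
          u (radialChange a k ν ρ • ω) ^ 2) -
        hardyBoundaryDeriv a k ν u ω (radialChange a k ν ρ)) := by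
  have hXP := XPos_radialChange (ν := ν) hc hρ
  have hr := hXP.pos
  have hPk := hXP.XProd_pos (Nat.le_succ k)
  have hP1 := hXP.XProd_pos le_rfl
  have hX := Xiter_radialChange a k ν ρ
  have hPX := XProd_succ a k (radialChange a k ν ρ)
  have hκ := radialWeight_sq (ν := ν) hc hρ
  rw [norm_gradient_radialTransform_sq hu hω hρ (hasDerivAt_radialChange hν hc hρ)
    (hasDerivAt_radialWeight hν hc hρ), hardyBoundaryDeriv]
  have hq := inner_sq_le_norm_sq (gradient u (radialChange a k ν ρ • ω)) hω
  have hν' : (0 : ℝ) < ν := by positivity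
  rw [hX] at hPX
  generalize radialChange a k ν ρ = r at *
  generalize radialWeight a k ν ρ = κ at *
  generalize hardyExponent a k ν r = h
  generalize hardyWeight a k ν r = W
  generalize u (r • ω) = U
  generalize ‖gradient u (r • ω)‖ ^ 2 = q at *
  generalize (inner ℝ (gradient u (r • ω)) ω : ℝ) = p at *
  generalize Xiter a (k + 1) 1 = c at *
  have key : (q - p ^ 2) * (r ^ (ν + 2) / ρ) *
      (ν / XProd a (k + 1) r - XProd a (k + 1) r / ν) ≥ 0 := by
    have h1 : XProd a (k + 1) r / ν ≤ 1 := (div_le_one hν').2 hP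
    have h2 : 1 ≤ ν / XProd a (k + 1) r := (one_le_div hP1).2 hP
    have h3 : 0 ≤ ν / XProd a (k + 1) r - XProd a (k + 1) r / ν := by linarith
    have h4 : 0 ≤ q - p ^ 2 := by linarith
    positivity
  have hκ' : (κ * (r / ρ)) ^ 2 * (q - p ^ 2) +
      (κ * (ν * r / (ρ * XProd a (k + 1) r)) * p +
        U * (-(h / r) * (ν * r / (ρ * XProd a (k + 1) r)) * κ)) ^ 2 =
      r ^ ν * XProd a k r * ((r / ρ) ^ 2 * (q - p ^ 2) +
        ((ν * r / (ρ * XProd a (k + 1) r)) * (p - h / r * U)) ^ 2) := by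
    rw [← hκ]; ring
  rw [hκ', ← sub_nonneg]
  refine le_of_le_of_eq key ?_
  rw [hPX]
  obtain ⟨m, rfl⟩ := Nat.exists_eq_succ_of_ne_zero hν
  simp only [Nat.succ_eq_add_one, Nat.add_sub_cancel] at *
  field_simp
  ring

lemma setIntegral_Ioo_half_eq (hν : ν ≠ 0) (h : ∀ s ∈ Set.Ioc (0 : ℝ) 1, XPos a (k + 1) s)
    (g : ℝ → ℝ) :
    ∫ r in Set.Ioo 0 1, g r = ∫ ρ in Set.Ioo 0 (1 / 2), (ν * radialChange a k ν ρ /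
      (ρ * XProd a (k + 1) (radialChange a k ν ρ))) * g (radialChange a k ν ρ) := by
  have hc := h 1 (by norm_num) (k + 1) le_rfl
  rw [← image_radialChange hν h, integral_image_eq_integral_abs_deriv_smul measurableSet_Ioo
    (fun ρ hρ => (hasDerivAt_radialChange hν hc hρ.1).hasDerivWithinAt)
    (injOn_radialChange hν hc)]
  refine setIntegral_congr_fun measurableSet_Ioo fun ρ hρ => ?_
  have h1 := XPos_radialChange (ν := ν) hc hρ.1
  have h2 := h1.XProd_pos le_rfl
  have h3 := h1.pos
  have h4 := hρ.1
  rw [abs_of_nonneg (by positivity), smul_eq_mul]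

lemma integrableOn_Ioo_half (hν : ν ≠ 0) (h : ∀ s ∈ Set.Ioc (0 : ℝ) 1, XPos a (k + 1) s)
    {g : ℝ → ℝ} (hg : IntegrableOn g (Set.Ioo 0 1)) :
    IntegrableOn (fun ρ => (ν * radialChange a k ν ρ /
      (ρ * XProd a (k + 1) (radialChange a k ν ρ))) * g (radialChange a k ν ρ))
      (Set.Ioo 0 (1 / 2)) := by
  have hc := h 1 (by norm_num) (k + 1) le_rfl
  rw [← image_radialChange hν h, integrableOn_image_iff_integrableOn_abs_deriv_smul
    measurableSet_Ioo
    (fun ρ hρ => (hasDerivAt_radialChange hν hc hρ.1).hasDerivWithinAt)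
    (injOn_radialChange hν hc)] at hg
  refine hg.congr_fun (fun ρ hρ => ?_) measurableSet_Ioo
  have h1 := XPos_radialChange (ν := ν) hc hρ.1
  have h2 := h1.XProd_pos le_rfl
  have h3 := h1.pos
  have h4 := hρ.1
  dsimp only
  rw [abs_of_nonneg (by positivity), smul_eq_mul]

lemma contBddUnit_hardy_ray (hν : ν ≠ 0) (h : ∀ s ∈ Set.Ioc (0 : ℝ) 1, XPos a k s)
    (hu : ContDiff ℝ 1 u) :
    ContBddUnit fun r => r ^ (ν + 1) * (‖gradient u (r • ω)‖ ^ 2 -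
      hardyWeight a k ν r / r ^ 2 * u (r • ω) ^ 2) := by
  have hωc : Continuous fun r : ℝ => r • ω := by fun_prop
  have hU : Continuous fun r : ℝ => r ^ (ν - 1) * u (r • ω) ^ 2 :=
    (continuous_pow _).mul ((hu.continuous.comp hωc).pow 2)
  have hq : Continuous fun r : ℝ => r ^ (ν + 1) * ‖gradient u (r • ω)‖ ^ 2 :=
    (continuous_pow _).mul (((continuous_gradient hu).comp hωc).norm.pow 2)
  refine ((ContBddUnit.of_continuous hq).sub
    ((ContBddUnit.hardyWeight (ν := ν) h).mul (ContBddUnit.of_continuous hU))).congr fun r hr => ?_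
  have hr' := hr.1
  obtain ⟨m, rfl⟩ := Nat.exists_eq_succ_of_ne_zero hν
  simp only [Nat.succ_eq_add_one, Nat.add_sub_cancel] at *
  field_simp
  ring

lemma hardy_ray (hν : ν ≠ 0) (h : ∀ s ∈ Set.Ioc (0 : ℝ) 1, XPos a (k + 1) s)
    (hP : XProd a (k + 1) 1 ≤ ν) (hu : ContDiff ℝ 1 u)
    (hsupp : tsupport u ⊆ Metric.ball 0 1) (hω : ‖ω‖ = 1) {D : EuclideanSpace ℝ (Fin n) → ℝ}
    (hD : ∀ y, 0 ≤ D y) (hDle : ∀ y ≠ 0, D y ≤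
      ‖gradient (radialTransform (radialChange a k ν) (radialWeight a k ν) u) y‖ ^ 2) :
    ∫ ρ in Set.Ioo 0 (1 / 2), ρ ^ (ν + 1) * (Xiter a (k + 1) 1 * 2 ^ ν / ν * D (ρ • ω)) ≤
      ∫ r in Set.Ioo 0 1, r ^ (ν + 1) * (‖gradient u (r • ω)‖ ^ 2 -
        hardyWeight a k ν r / r ^ 2 * u (r • ω) ^ 2) := by
  have hc := h 1 (by norm_num) (k + 1) le_rfl
  have hk : ∀ s ∈ Set.Ioc (0 : ℝ) 1, XPos a k s := fun s hs => (h s hs).mono (Nat.le_succ k)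
  have hI := (contBddUnit_hardy_ray (ω := ω) hν hk hu).integrableOn
  have hB := (ContBddUnit.hardyBoundaryDeriv (ν := ν) (ω := ω) hu hk).integrableOn
  have hE := integral_sub hI hB
  rw [integral_hardyBoundaryDeriv hν hu hsupp hk hω, sub_zero] at hE
  rw [← hE, setIntegral_Ioo_half_eq hν h]
  refine integral_mono_of_nonneg ?_ (integrableOn_Ioo_half hν h (hI.sub hB)) ?_
  · refine (ae_restrict_iff' measurableSet_Ioo).2 (Filter.Eventually.of_forall fun ρ hρ => ?_)
    have := hρ.1
    have := hD (ρ • ω)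
    simp only [Pi.zero_apply]
    positivity
  · refine (ae_restrict_iff' measurableSet_Ioo).2 (Filter.Eventually.of_forall fun ρ hρ => ?_)
    have h0 := hρ.1
    have h1 : ρ • ω ≠ 0 := by
      rw [← norm_ne_zero_iff, norm_smul, hω, mul_one]
      exact norm_ne_zero_iff.2 h0.ne'
    refine le_trans ?_ (norm_gradient_radialTransform_sq_le hν hc hu hω h0 ?_)
    · have := hDle _ h1
      dsimp only
      gcongr
    · refine le_trans ?_ hP
      have h2 := (image_radialChange hν h).subset (Set.mem_image_of_mem _ hρ)
      exact XProd_le_XProd (XPos_radialChange hc h0) (h 1 (by norm_num)) h2.2.le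

lemma sobolev_ray (hν : ν ≠ 0) (h : ∀ s ∈ Set.Ioc (0 : ℝ) 1, XPos a (k + 1) s)
    (hω : ‖ω‖ = 1) :
    ∫ ρ in Set.Ioo 0 (1 / 2), ρ ^ (ν + 1) *
      (ν * (Xiter a (k + 1) 1 * 2 ^ ν) ^ (((ν : ℝ) + 2) / ν) *
      (radialTransform (radialChange a k ν) (radialWeight a k ν) u (ρ • ω) ^ 2) ^
        (((ν : ℝ) + 2) / ν)) =
      ∫ r in Set.Ioo 0 1, r ^ (ν + 1) * (XProd a (k + 1) r ^ (2 * ((ν : ℝ) + 1) / ν) *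
        |u (r • ω)| ^ (2 * ((ν : ℝ) + 2) / ν)) := by
  have hc := h 1 (by norm_num) (k + 1) le_rfl
  rw [setIntegral_Ioo_half_eq hν h]
  refine setIntegral_congr_fun measurableSet_Ioo fun ρ hρ => ?_
  have h0 := hρ.1
  have hXP := XPos_radialChange (ν := ν) hc h0
  have hr := hXP.pos
  have hPk := hXP.XProd_pos (Nat.le_succ k)
  have hP1 := hXP.XProd_pos le_rfl
  have hX := Xiter_radialChange a k ν ρ
  have hPX := XProd_succ a k (radialChange a k ν ρ)
  have hν' : (0 : ℝ) < ν := by positivity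
  rw [radialTransform_smul hω h0, mul_pow, radialWeight_sq hc h0]
  rw [hX] at hPX
  generalize radialChange a k ν ρ = r at *
  have hd : 0 < Xiter a (k + 1) 1 * 2 ^ ν := by positivity
  generalize Xiter a (k + 1) 1 * 2 ^ ν = d at *
  have e1 : (u (r • ω) ^ 2) ^ (((ν : ℝ) + 2) / ν) = |u (r • ω)| ^ (2 * ((ν : ℝ) + 2) / ν) := by
    rw [← sq_abs, ← rpow_natCast, ← rpow_mul (abs_nonneg _)]
    congr 1
    push_cast
    ring
  have e2 : (r ^ ν) ^ (((ν : ℝ) + 2) / ν) = r ^ (ν + 2) := by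
    rw [← rpow_natCast, ← rpow_mul hr.le, mul_div_cancel₀ _ hν'.ne', ← rpow_natCast]
    push_cast; rfl
  have e3 : (ρ ^ ν) ^ (((ν : ℝ) + 2) / ν) = ρ ^ (ν + 2) := by
    rw [← rpow_natCast, ← rpow_mul h0.le, mul_div_cancel₀ _ hν'.ne', ← rpow_natCast]
    push_cast; rfl
  have e4 : XProd a (k + 1) r ^ (2 * ((ν : ℝ) + 1) / ν) =
      XProd a (k + 1) r * (XProd a k r ^ (((ν : ℝ) + 2) / ν) *
        (d ^ (((ν : ℝ) + 2) / ν) * ρ ^ (ν + 2))) := by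
    rw [← e3, ← mul_rpow (by positivity) (by positivity), ← mul_rpow (by positivity)
      (by positivity), ← hPX]
    nth_rewrite 2 [← rpow_one (XProd a (k + 1) r)]
    rw [← rpow_add hP1]
    congr 1
    field_simp
    ring
  rw [mul_rpow (by positivity) (by positivity), mul_rpow (by positivity) (by positivity), e1, e2,
    e4]
  field_simp
  ring

end

/-- A continuous cutoff vanishing for `m|s| ≤ 1` and equal to `1` for `m|s| ≥ 2`. -/
noncomputable def cutoffDensity (m : ℕ) (s : ℝ) : ℝ := min 1 (max 0 (m * |s| - 1))

/-- A `C¹` contraction of the line vanishing near the origin. -/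
noncomputable def truncation (m : ℕ) (t : ℝ) : ℝ := ∫ s in (0 : ℝ)..t, cutoffDensity m s

lemma continuous_cutoffDensity (m : ℕ) : Continuous (cutoffDensity m) := by
  unfold cutoffDensity
  fun_prop

lemma norm_cutoffDensity_le (m : ℕ) (s : ℝ) : ‖cutoffDensity m s‖ ≤ 1 := by
  rw [cutoffDensity, norm_of_nonneg (le_min zero_le_one (le_max_left _ _))]
  exact min_le_left _ _

lemma hasDerivAt_truncation (m : ℕ) (t : ℝ) :
    HasDerivAt (truncation m) (cutoffDensity m t) t :=
  (continuous_cutoffDensity m).integral_hasStrictDerivAt 0 t |>.hasDerivAt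

lemma contDiff_truncation (m : ℕ) : ContDiff ℝ 1 (truncation m) := by
  have h : deriv (truncation m) = cutoffDensity m := funext fun t =>
    (hasDerivAt_truncation m t).deriv
  rw [contDiff_one_iff_deriv, h]
  exact ⟨fun t => (hasDerivAt_truncation m t).differentiableAt, continuous_cutoffDensity m⟩

lemma abs_truncation_le (m : ℕ) (t : ℝ) : |truncation m t| ≤ |t| := by
  have := intervalIntegral.norm_integral_le_of_norm_le_const (a := 0) (b := t) (C := 1)
    (f := cutoffDensity m) fun s _ => norm_cutoffDensity_le m s
  simpa [truncation] using this

lemma truncation_eq_zero {m : ℕ} {t : ℝ} (h : m * |t| ≤ 1) : truncation m t = 0 := by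
  have : ∀ s ∈ Set.uIcc 0 t, cutoffDensity m s = 0 := fun s hs => by
    have h1 : |s| ≤ |t| := by simpa using Set.abs_sub_left_of_mem_uIcc hs
    have h2 : m * |s| - 1 ≤ 0 := by
      have : m * |s| ≤ m * |t| := by gcongr
      linarith
    rw [cutoffDensity, max_eq_left h2, min_eq_right zero_le_one]
  rw [truncation, intervalIntegral.integral_congr this]
  simp

lemma tendsto_truncation (t : ℝ) :
    Filter.Tendsto (fun m => truncation m t) Filter.atTop (nhds t) := by
  have h : Filter.Tendsto (fun m => truncation m t) Filter.atTop
      (nhds (∫ _ in (0 : ℝ)..t, (1 : ℝ))) := by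
    refine intervalIntegral.tendsto_integral_filter_of_dominated_convergence (fun _ => 1)
      (Filter.Eventually.of_forall fun m => (continuous_cutoffDensity m).aestronglyMeasurable)
      (Filter.Eventually.of_forall fun m => Filter.Eventually.of_forall fun s _ =>
        norm_cutoffDensity_le m s) (by simp) ?_
    have h0 : ∀ᵐ s : ℝ, s ≠ 0 := by simp [ae_iff]
    filter_upwards [h0] with s hs _
    have h1 : Filter.Tendsto (fun m : ℕ => (m : ℝ) * |s|) Filter.atTop Filter.atTop :=
      tendsto_natCast_atTop_atTop.atTop_mul_const (abs_pos.2 hs)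
    refine tendsto_const_nhds.congr' ?_
    filter_upwards [h1.eventually_ge_atTop 2] with m hm
    rw [cutoffDensity, min_eq_left]
    exact le_max_of_le_right (by linarith)
  simpa using h

lemma norm_gradient_eq_norm_fderiv {n : ℕ} (w : EuclideanSpace ℝ (Fin n) → ℝ)
    (y : EuclideanSpace ℝ (Fin n)) : ‖gradient w y‖ = ‖fderiv ℝ w y‖ :=
  (InnerProductSpace.toDual ℝ _).symm.norm_map _

lemma norm_gradient_truncation_comp_sq_le {n : ℕ} (m : ℕ) {w : EuclideanSpace ℝ (Fin n) → ℝ}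
    {y : EuclideanSpace ℝ (Fin n)} (hw : DifferentiableAt ℝ w y) :
    ‖gradient (fun x => truncation m (w x)) y‖ ^ 2 ≤ ‖gradient w y‖ ^ 2 := by
  have h := HasDerivAt.comp_hasFDerivAt y (hasDerivAt_truncation m (w y)) hw.hasFDerivAt
  have h' : fderiv ℝ (fun x => truncation m (w x)) y = cutoffDensity m (w y) • fderiv ℝ w y :=
    h.fderiv
  rw [norm_gradient_eq_norm_fderiv, norm_gradient_eq_norm_fderiv, h', norm_smul]
  gcongr
  exact mul_le_of_le_one_left (norm_nonneg _) (norm_cutoffDensity_le _ _)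

section

variable {n k ν : ℕ} {a : ℝ} {u : EuclideanSpace ℝ (Fin n) → ℝ}

lemma tendsto_radialWeight (hν : ν ≠ 0) (h : ∀ s ∈ Set.Ioc (0 : ℝ) 1, XPos a (k + 1) s) :
    Filter.Tendsto (radialWeight a k ν) (nhds 0) (nhds 0) := by
  have hc := h 1 (by norm_num) (k + 1) le_rfl
  rw [← nhdsLE_sup_nhdsGT (0 : ℝ), Filter.tendsto_sup, nhdsLE_sup_nhdsGT]
  constructor
  · refine tendsto_const_nhds.congr' ?_
    filter_upwards [self_mem_nhdsWithin] with ρ hρ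
    exact (if_neg (not_lt.2 hρ)).symm
  · have h1 : Filter.Tendsto (fun ρ => sqrt (radialChange a k ν ρ ^ ν * XProd a k 1))
        (nhdsWithin 0 (Set.Ioi 0)) (nhds 0) := by
      have h2 := (((tendsto_radialChange hν hc).mono_right nhdsWithin_le_nhds).pow ν).mul_const
        (XProd a k 1)
      have h3 := (continuous_sqrt.tendsto _).comp h2
      simpa [zero_pow hν, Function.comp_def] using h3
    refine squeeze_zero' (Filter.Eventually.of_forall fun ρ => radialWeight_nonneg) ?_ h1
    filter_upwards [Ioo_mem_nhdsGT (show (0 : ℝ) < 1 / 2 by norm_num)] with ρ hρ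
    have h2 := (image_radialChange hν h).subset (Set.mem_image_of_mem _ hρ)
    rw [radialWeight_of_pos hρ.1]
    have h3 := h2.1
    have h4 := XProd_le_XProd ((XPos_radialChange (ν := ν) hc hρ.1).mono (Nat.le_succ k))
      ((h 1 (by norm_num)).mono (Nat.le_succ k)) h2.2.le
    gcongr

lemma contDiffAt_radialTransform (hc : 0 < Xiter a (k + 1) 1) (hu : ContDiff ℝ 1 u)
    {y : EuclideanSpace ℝ (Fin n)} (hy : y ≠ 0) :
    ContDiffAt ℝ 1 (radialTransform (radialChange a k ν) (radialWeight a k ν) u) y := by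
  have h1 : ContDiffAt ℝ 1 (fun x : EuclideanSpace ℝ (Fin n) => ‖x‖) y := contDiffAt_norm ℝ hy
  have hy' := norm_pos_iff.2 hy
  have h2 : ContDiffAt ℝ 1 (fun x : EuclideanSpace ℝ (Fin n) => radialChange a k ν ‖x‖) y :=
    (contDiffAt_radialChange (ν := ν) hc hy').comp (g := radialChange a k ν) y h1
  have h3 : ContDiffAt ℝ 1 (fun x : EuclideanSpace ℝ (Fin n) => radialWeight a k ν ‖x‖) y :=
    (contDiffAt_radialWeight (ν := ν) hc hy').comp (g := radialWeight a k ν) y h1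
  have h4 : ContDiffAt ℝ 1
      (fun x : EuclideanSpace ℝ (Fin n) => (radialChange a k ν ‖x‖ / ‖x‖) • x) y :=
    (h2.div h1 hy'.ne').smul contDiffAt_id
  exact (hu.contDiffAt.comp y h4).mul h3

lemma continuous_radialTransform (hν : ν ≠ 0) (h : ∀ s ∈ Set.Ioc (0 : ℝ) 1, XPos a (k + 1) s)
    (hu : ContDiff ℝ 1 u) (hcs : HasCompactSupport u) :
    Continuous (radialTransform (radialChange a k ν) (radialWeight a k ν) u) := by
  have hc := h 1 (by norm_num) (k + 1) le_rfl
  rw [continuous_iff_continuousAt]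
  intro y
  rcases eq_or_ne y 0 with rfl | hy
  · obtain ⟨M, hM⟩ := hcs.exists_bound_of_continuous hu.continuous
    have h0 : radialTransform (radialChange a k ν) (radialWeight a k ν) u 0 = 0 := by
      simp [radialTransform, radialWeight]
    rw [ContinuousAt, h0]
    have h1 : Filter.Tendsto (fun x : EuclideanSpace ℝ (Fin n) => M * radialWeight a k ν ‖x‖)
        (nhds 0) (nhds 0) := by
      have := ((tendsto_radialWeight hν h).comp
        (tendsto_norm_zero (E := EuclideanSpace ℝ (Fin n)))).const_mul M
      simpa using this
    refine squeeze_zero_norm (fun x => ?_) h1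
    rw [radialTransform, norm_mul, norm_of_nonneg (radialWeight_nonneg (ρ := ‖x‖))]
    exact mul_le_mul_of_nonneg_right (hM _) radialWeight_nonneg
  · exact (contDiffAt_radialTransform hc hu hy).continuousAt

lemma radialTransform_zero (ψ : ℝ → ℝ) :
    radialTransform ψ (radialWeight a k ν) u 0 = 0 := by
  simp [radialTransform, radialWeight]

lemma contDiff_truncation_radialTransform (hν : ν ≠ 0)
    (h : ∀ s ∈ Set.Ioc (0 : ℝ) 1, XPos a (k + 1) s)
    (hu : ContDiff ℝ 1 u) (hcs : HasCompactSupport u) (m : ℕ) :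
    ContDiff ℝ 1 fun x =>
      truncation m (radialTransform (radialChange a k ν) (radialWeight a k ν) u x) := by
  have hc := h 1 (by norm_num) (k + 1) le_rfl
  rw [contDiff_iff_contDiffAt]
  intro y
  rcases eq_or_ne y 0 with rfl | hy
  · have h1 := (continuous_radialTransform hν h hu hcs).abs.const_mul (m : ℝ) |>.tendsto 0
    rw [radialTransform_zero, abs_zero, mul_zero] at h1
    refine (contDiffAt_const (c := (0 : ℝ))).congr_of_eventuallyEq ?_
    filter_upwards [h1.eventually (gt_mem_nhds zero_lt_one)] with x hx
    exact truncation_eq_zero hx.le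
  · exact (contDiff_truncation m).contDiffAt.comp y (contDiffAt_radialTransform hc hu hy)

lemma radialTransform_eq_zero (hν : ν ≠ 0)
    (h : ∀ s ∈ Set.Ioc (0 : ℝ) 1, XPos a (k + 1) s) (hsupp : tsupport u ⊆ Metric.ball 0 1) :
    ∃ R < 1 / 2, ∀ y, R < ‖y‖ →
      radialTransform (radialChange a k ν) (radialWeight a k ν) u y = 0 := by
  have hc := h 1 (by norm_num) (k + 1) le_rfl
  obtain ⟨R', hR', hs⟩ := exists_lt_subset_ball (isClosed_tsupport u) hsupp
  have h1 : max R' (1 / 2) ∈ Set.Ioo (0 : ℝ) 1 :=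
    ⟨lt_max_of_lt_right (by norm_num), max_lt hR' (by norm_num)⟩
  rw [← image_radialChange hν h] at h1
  obtain ⟨R, hR, hψ⟩ := h1
  refine ⟨R, hR.2, fun y hy => ?_⟩
  have hy0 : 0 < ‖y‖ := hR.1.trans hy
  have h2 := radialChange_lt hν hc hR.1 hy
  have h3 := radialChange_pos (ν := ν) hc hy0
  suffices hmem : (radialChange a k ν ‖y‖ / ‖y‖) • y ∉ tsupport u by
    rw [radialTransform, image_eq_zero_of_notMem_tsupport hmem, zero_mul]
  intro hmem
  have h4 := hs hmem
  rw [mem_ball_zero_iff, norm_smul, norm_of_nonneg (by positivity),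
    div_mul_cancel₀ _ hy0.ne'] at h4
  rw [hψ] at h2
  exact absurd ((le_max_left R' (1 / 2)).trans_lt h2) h4.not_gt

lemma tsupport_truncation_radialTransform (hν : ν ≠ 0)
    (h : ∀ s ∈ Set.Ioc (0 : ℝ) 1, XPos a (k + 1) s) (hsupp : tsupport u ⊆ Metric.ball 0 1)
    (m : ℕ) :
    tsupport (fun x => truncation m
      (radialTransform (radialChange a k ν) (radialWeight a k ν) u x)) ⊆
      Metric.ball 0 (1 / 2) := by
  obtain ⟨R, hR, hz⟩ := radialTransform_eq_zero hν h hsupp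
  refine (closure_minimal (t := Metric.closedBall 0 R) (fun y hy => ?_)
    Metric.isClosed_closedBall).trans (Metric.closedBall_subset_ball hR)
  rw [mem_closedBall_zero_iff]
  by_contra! hlt
  exact hy (by simp only [hz y hlt]; exact truncation_eq_zero (by simp))

end

section

variable {n k ν : ℕ} {a : ℝ} {u : EuclideanSpace ℝ (Fin n) → ℝ}

lemma ContBddUnit.integrableOn_ball_mul (hn : 1 < n) {f : ℝ → ℝ} (hf : ContBddUnit f)
    {g : EuclideanSpace ℝ (Fin n) → ℝ} (hg : Continuous g) (hcs : HasCompactSupport g) :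
    IntegrableOn (fun x => f ‖x‖ * g x) (Metric.ball 0 1) := by
  have : Nontrivial (EuclideanSpace ℝ (Fin n)) :=
    Module.nontrivial_of_finrank_pos (R := ℝ) (by simp; omega)
  obtain ⟨M, hM⟩ := hcs.exists_bound_of_continuous hg
  have h1 : IntegrableOn (fun x : EuclideanSpace ℝ (Fin n) => f ‖x‖) (Metric.ball 0 1) := by
    rw [integrableOn_fun_norm_addHaar]
    exact ((ContBddUnit.of_continuous (continuous_pow _)).mul hf).integrableOn
  exact Integrable.mul_bdd (c := M) h1 hg.aestronglyMeasurable (Filter.Eventually.of_forall hM)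

lemma ContBddUnit.integrableOn_ball_div_sq_mul (hn : 3 ≤ n) {f : ℝ → ℝ} (hf : ContBddUnit f)
    {g : EuclideanSpace ℝ (Fin n) → ℝ} (hg : Continuous g) (hcs : HasCompactSupport g) :
    IntegrableOn (fun x => f ‖x‖ / ‖x‖ ^ 2 * g x) (Metric.ball 0 1) := by
  have : Nontrivial (EuclideanSpace ℝ (Fin n)) :=
    Module.nontrivial_of_finrank_pos (R := ℝ) (by simp; omega)
  obtain ⟨M, hM⟩ := hcs.exists_bound_of_continuous hg
  have h1 : IntegrableOn (fun x : EuclideanSpace ℝ (Fin n) => f ‖x‖ / ‖x‖ ^ 2)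
      (Metric.ball 0 1) := by
    rw [integrableOn_fun_norm_addHaar volume (f := fun r => f r / r ^ 2)]
    refine (((ContBddUnit.of_continuous (continuous_pow (n - 3))).mul hf).congr
      fun r hr => ?_).integrableOn
    obtain ⟨m, rfl⟩ := Nat.exists_eq_add_of_le' hn
    have := hr.1
    simp
    field_simp
    ring
  exact Integrable.mul_bdd (c := M) h1 hg.aestronglyMeasurable (Filter.Eventually.of_forall hM)

lemma contBddUnit_XProd_rpow (h : ∀ s ∈ Set.Ioc (0 : ℝ) 1, XPos a k s) {p : ℝ} (hp : 0 ≤ p) :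
    ContBddUnit fun r => XProd a k r ^ p := by
  obtain ⟨hc, M, hM⟩ := ContBddUnit.XProd h
  refine ⟨hc.rpow_const fun r _ => Or.inr hp, M ^ p, fun r hr => ?_⟩
  exact (abs_rpow_le_abs_rpow _ _).trans (rpow_le_rpow (abs_nonneg _) (hM r hr) hp)

lemma tendsto_setIntegral_truncation {w : EuclideanSpace ℝ (Fin n) → ℝ} (hw : Continuous w)
    {R p : ℝ} (hp : 0 ≤ p) :
    Filter.Tendsto (fun m => ∫ x in Metric.ball 0 R, (truncation m (w x) ^ 2) ^ p) Filter.atTop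
      (nhds (∫ x in Metric.ball 0 R, (w x ^ 2) ^ p)) := by
  have hwp : Continuous fun x => (w x ^ 2) ^ p := (hw.pow 2).rpow_const fun _ => Or.inr hp
  refine tendsto_integral_of_dominated_convergence (fun x => (w x ^ 2) ^ p) (fun m => ?_) ?_
    (fun m => ?_) ?_
  · exact ((((contDiff_truncation m).continuous.comp hw).pow 2).rpow_const
      fun _ => Or.inr hp).aestronglyMeasurable
  · exact (hwp.continuousOn.integrableOn_compact (isCompact_closedBall 0 R)).mono_set
      Metric.ball_subset_closedBall
  · refine Filter.Eventually.of_forall fun x => ?_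
    rw [norm_of_nonneg (by positivity)]
    exact rpow_le_rpow (sq_nonneg _) (sq_le_sq.2 (abs_truncation_le _ _)) hp
  · refine Filter.Eventually.of_forall fun x => ?_
    exact ((tendsto_truncation (w x)).pow 2).rpow_const (Or.inr hp)

lemma integrableOn_hardy (hn : 3 ≤ n) (h : ∀ s ∈ Set.Ioc (0 : ℝ) 1, XPos a k s)
    (hu : ContDiff ℝ 1 u) (hcs : HasCompactSupport u) :
    IntegrableOn (fun x => hardyWeight a k ν ‖x‖ / ‖x‖ ^ 2 * u x ^ 2) (Metric.ball 0 1) :=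
  (ContBddUnit.hardyWeight h).integrableOn_ball_div_sq_mul hn (hu.continuous.pow 2)
    (hcs.comp_left (g := fun t => t ^ 2) (by simp))

lemma integrableOn_norm_gradient_sq (hu : ContDiff ℝ 1 u) {R : ℝ} :
    IntegrableOn (fun x => ‖gradient u x‖ ^ 2) (Metric.ball 0 R) :=
  ((continuous_gradient hu).norm.pow 2).continuousOn.integrableOn_compact
    (isCompact_closedBall 0 R) |>.mono_set Metric.ball_subset_closedBall

lemma hardy_sobolev_transformed {u : EuclideanSpace ℝ (Fin (ν + 2)) → ℝ} (hν : ν ≠ 0)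
    (h : ∀ s ∈ Set.Ioc (0 : ℝ) 1, XPos a (k + 1) s) (hP : XProd a (k + 1) 1 ≤ ν)
    (hu : ContDiff ℝ 1 u) (hcs : HasCompactSupport u) (hsupp : tsupport u ⊆ Metric.ball 0 1) :
    Xiter a (k + 1) 1 * 2 ^ ν / ν * (sobolevConst (ν + 2) * (∫ x in Metric.ball 0 (1 / 2),
      (radialTransform (radialChange a k ν) (radialWeight a k ν) u x ^ 2) ^
        (((ν : ℝ) + 2) / ν)) ^ ((ν : ℝ) / (ν + 2))) ≤
    ∫ x in Metric.ball 0 1, (‖gradient u x‖ ^ 2 -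
      hardyWeight a k ν ‖x‖ / ‖x‖ ^ 2 * u x ^ 2) := by
  have hc := h 1 (by norm_num) (k + 1) le_rfl
  have hν' : (0 : ℝ) < ν := by positivity
  have hw := continuous_radialTransform hν h hu hcs
  have ht := (((tendsto_setIntegral_truncation hw (R := 1 / 2)
    (p := ((ν : ℝ) + 2) / ν) (by positivity)).rpow_const (p := (ν : ℝ) / (ν + 2))
    (Or.inr (by positivity))).const_mul (sobolevConst (ν + 2))).const_mul
    (Xiter a (k + 1) 1 * 2 ^ ν / ν)
  refine le_of_tendsto' ht fun m => ?_
  have hm := contDiff_truncation_radialTransform hν h hu hcs m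
  have hS := sobolev_ball (by omega) hm (tsupport_truncation_radialTransform hν h hsupp m)
  push_cast at hS
  rw [add_sub_cancel_right] at hS
  refine (mul_le_mul_of_nonneg_left hS (by positivity)).trans ?_
  rw [← integral_const_mul]
  refine setIntegral_ball_le_of_rays (by omega) ((integrableOn_norm_gradient_sq hm).const_mul _)
    ((integrableOn_norm_gradient_sq hu).sub
      (integrableOn_hardy (by omega) (fun s hs => (h s hs).mono (Nat.le_succ k)) hu hcs))
    fun ω hω => ?_
  refine (hardy_ray hν h hP hu hsupp hω (fun y => sq_nonneg _) fun y hy =>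
    norm_gradient_truncation_comp_sq_le m
      ((contDiffAt_radialTransform hc hu hy).differentiableAt one_ne_zero)).trans_eq ?_
  refine setIntegral_congr_fun measurableSet_Ioo fun r hr => ?_
  simp only [norm_smul, hω, norm_of_nonneg hr.1.le, mul_one,
    show ν + 2 - 1 = ν + 1 from rfl]

lemma integrableOn_ball_XProd_rpow (hn : 1 < n) (h : ∀ s ∈ Set.Ioc (0 : ℝ) 1, XPos a k s)
    (hu : ContDiff ℝ 1 u) (hcs : HasCompactSupport u) {p q : ℝ} (hp : 0 ≤ p) (hq : 0 < q) :
    IntegrableOn (fun x => XProd a k ‖x‖ ^ p * |u x| ^ q) (Metric.ball 0 1) :=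
  (contBddUnit_XProd_rpow h hp).integrableOn_ball_mul hn
    (hu.continuous.abs.rpow_const fun _ => Or.inr hq.le)
    (hcs.comp_left (g := fun t => |t| ^ q) (by simp [hq.ne']))

lemma integral_radialTransform_rpow {u : EuclideanSpace ℝ (Fin (ν + 2)) → ℝ} (hν : ν ≠ 0)
    (h : ∀ s ∈ Set.Ioc (0 : ℝ) 1, XPos a (k + 1) s)
    (hu : ContDiff ℝ 1 u) (hcs : HasCompactSupport u) :
    ν * (Xiter a (k + 1) 1 * 2 ^ ν) ^ (((ν : ℝ) + 2) / ν) * (∫ x in Metric.ball 0 (1 / 2),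
      (radialTransform (radialChange a k ν) (radialWeight a k ν) u x ^ 2) ^
        (((ν : ℝ) + 2) / ν)) =
    ∫ x in Metric.ball 0 1, XProd a (k + 1) ‖x‖ ^ (2 * ((ν : ℝ) + 1) / ν) *
        |u x| ^ (2 * ((ν : ℝ) + 2) / ν) := by
  have hν' : (0 : ℝ) < ν := by positivity
  have hw := continuous_radialTransform hν h hu hcs
  have hF : IntegrableOn (fun x => ν * (Xiter a (k + 1) 1 * 2 ^ ν) ^ (((ν : ℝ) + 2) / ν) *
      (radialTransform (radialChange a k ν) (radialWeight a k ν) u x ^ 2) ^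
        (((ν : ℝ) + 2) / ν)) (Metric.ball 0 (1 / 2)) :=
    (continuous_const.mul ((hw.pow 2).rpow_const fun _ =>
      Or.inr (by positivity))).continuousOn.integrableOn_compact
      (isCompact_closedBall 0 (1 / 2)) |>.mono_set Metric.ball_subset_closedBall
  have hG := integrableOn_ball_XProd_rpow (by omega) h hu hcs
    (p := 2 * ((ν : ℝ) + 1) / ν) (q := 2 * ((ν : ℝ) + 2) / ν) (by positivity) (by positivity)
  rw [← integral_const_mul]
  have key : ∀ ω : EuclideanSpace ℝ (Fin (ν + 2)), ‖ω‖ = 1 → _ :=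
    fun ω hω => (sobolev_ray (u := u) hν h hω).trans
      (setIntegral_congr_fun (g := fun r => r ^ (ν + 1) *
        (XProd a (k + 1) ‖r • ω‖ ^ (2 * ((ν : ℝ) + 1) / ν) *
          |u (r • ω)| ^ (2 * ((ν : ℝ) + 2) / ν))) measurableSet_Ioo fun r hr => by
        simp only [norm_smul, hω, norm_of_nonneg hr.1.le, mul_one])
  exact le_antisymm (setIntegral_ball_le_of_rays (by omega) hF hG fun ω hω => (key ω hω).le)
    (setIntegral_ball_le_of_rays (by omega) hG hF fun ω hω => (key ω hω).ge)

theorem hardy_sobolev_improved {u : EuclideanSpace ℝ (Fin (ν + 2)) → ℝ} (hν : ν ≠ 0)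
    (h : ∀ s ∈ Set.Ioc (0 : ℝ) 1, XPos a (k + 1) s) (hP : XProd a (k + 1) 1 ≤ ν)
    (hu : ContDiff ℝ 1 u) (hcs : HasCompactSupport u) (hsupp : tsupport u ⊆ Metric.ball 0 1) :
    (ν : ℝ) ^ (-(2 * ((ν : ℝ) + 1)) / (ν + 2)) * sobolevConst (ν + 2) *
      (∫ x in Metric.ball 0 1, XProd a (k + 1) ‖x‖ ^ (2 * ((ν : ℝ) + 1) / ν) *
        |u x| ^ (2 * ((ν : ℝ) + 2) / ν)) ^ ((ν : ℝ) / (ν + 2)) ≤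
    ∫ x in Metric.ball 0 1, (‖gradient u x‖ ^ 2 -
      hardyWeight a k ν ‖x‖ / ‖x‖ ^ 2 * u x ^ 2) := by
  refine le_of_eq_of_le ?_ (hardy_sobolev_transformed hν h hP hu hcs hsupp)
  rw [← integral_radialTransform_rpow hν h hu hcs]
  have hν' : (0 : ℝ) < ν := by positivity
  have hc := h 1 (by norm_num) (k + 1) le_rfl
  have hd : 0 < Xiter a (k + 1) 1 * 2 ^ ν := by positivity
  have hJ : 0 ≤ ∫ x in Metric.ball 0 (1 / 2),
      (radialTransform (radialChange a k ν) (radialWeight a k ν) u x ^ 2) ^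
        (((ν : ℝ) + 2) / ν) := integral_nonneg fun x => by positivity
  generalize (∫ x in Metric.ball 0 (1 / 2),
      (radialTransform (radialChange a k ν) (radialWeight a k ν) u x ^ 2) ^
        (((ν : ℝ) + 2) / ν)) = J at *
  generalize Xiter a (k + 1) 1 * 2 ^ ν = d at *
  have e1 : (d ^ (((ν : ℝ) + 2) / ν)) ^ ((ν : ℝ) / (ν + 2)) = d := by
    rw [← rpow_mul hd.le, div_mul_div_cancel₀ hν'.ne', div_self (by positivity), rpow_one]
  have e2 : (ν : ℝ) ^ (-(2 * ((ν : ℝ) + 1)) / (ν + 2)) * (ν : ℝ) ^ ((ν : ℝ) / (ν + 2)) =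
      (ν : ℝ)⁻¹ := by
    rw [← rpow_add hν', ← rpow_neg_one]
    congr 1
    field_simp
    ring
  rw [mul_rpow (by positivity) hJ, mul_rpow (by positivity) (by positivity), e1]
  linear_combination (sobolevConst (ν + 2) * d * J ^ ((ν : ℝ) / (ν + 2))) * e2

end

theorem stmt18 (n : ℕ) (hn : 3 ≤ n) (k : ℕ) (hk : 1 ≤ k)
    (a : ℝ) (ha0 : 0 < a)
    (hdef : ∀ s ∈ Set.Ioc (0 : ℝ) 1, ∀ i, 1 ≤ i → i ≤ k → 0 < a - Real.log (Xiter a i s))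
    (hprod : (∏ i ∈ Finset.Icc 1 (k + 1), Xiter a i 1) ≤ (n : ℝ) - 2)
    (u : EuclideanSpace ℝ (Fin n) → ℝ) (hu : ContDiff ℝ (⊤ : ℕ∞) u)
    (hcs : HasCompactSupport u)
    (hsupp : tsupport u ⊆ Metric.ball (0 : EuclideanSpace ℝ (Fin n)) 1) :
    (∫ x in Metric.ball (0 : EuclideanSpace ℝ (Fin n)) 1, ‖gradient u x‖ ^ 2)
      ≥ (((n : ℝ) - 2) / 2) ^ 2 *
          (∫ x in Metric.ball (0 : EuclideanSpace ℝ (Fin n)) 1, u x ^ 2 / ‖x‖ ^ 2)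
        + (1 / 4 : ℝ) * (∑ i ∈ Finset.Icc 1 k,
          ∫ x in Metric.ball (0 : EuclideanSpace ℝ (Fin n)) 1,
            (∏ j ∈ Finset.Icc 1 i, (Xiter a j ‖x‖) ^ 2) / ‖x‖ ^ 2 * u x ^ 2)
        + ((n : ℝ) - 2) ^ (-(2 * ((n : ℝ) - 1)) / (n : ℝ)) * sobolevConst n *
          (∫ x in Metric.ball (0 : EuclideanSpace ℝ (Fin n)) 1,
              (∏ i ∈ Finset.Icc 1 (k + 1), Xiter a i ‖x‖)
                  ^ (2 * ((n : ℝ) - 1) / ((n : ℝ) - 2)) *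
                |u x| ^ (2 * (n : ℝ) / ((n : ℝ) - 2)))
            ^ (((n : ℝ) - 2) / (n : ℝ)) := by
  obtain ⟨ν, rfl⟩ := Nat.exists_eq_add_of_le' (show 2 ≤ n by omega)
  have hν : ν ≠ 0 := by omega
  have h : ∀ s ∈ Set.Ioc (0 : ℝ) 1, XPos a (k + 1) s := by
    intro s hs j hj
    cases j with
    | zero => exact hs.1
    | succ j =>
      rw [Xiter_succ, X1, inv_pos]
      rcases Nat.eq_zero_or_pos j with rfl | hj0
      · have := log_nonpos hs.1.le hs.2
        simp only [Xiter]
        linarith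
      · exact hdef s hs j hj0 (by omega)
  have hk : ∀ s ∈ Set.Ioc (0 : ℝ) 1, XPos a k s := fun s hs => (h s hs).mono (Nat.le_succ k)
  have hu1 : ContDiff ℝ 1 u := hu.of_le (by exact_mod_cast le_top)
  push_cast at hprod ⊢
  simp only [add_sub_cancel_right, show (ν : ℝ) + 2 - 1 = ν + 1 by ring] at hprod ⊢
  have hmain := hardy_sobolev_improved hν h hprod hu1 hcs hsupp
  have hsq : Continuous fun x => u x ^ 2 := hu1.continuous.pow 2
  have hsqc : HasCompactSupport fun x => u x ^ 2 := hcs.comp_left (g := fun t => t ^ 2) (by simp)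
  have i0 : IntegrableOn (fun x => u x ^ 2 / ‖x‖ ^ 2) (Metric.ball 0 1) := by
    have := (ContBddUnit.const 1).integrableOn_ball_div_sq_mul hn hsq hsqc
    refine this.congr_fun (fun x _ => ?_) measurableSet_ball
    ring
  have i1 : ∀ i ∈ Finset.Icc 1 k, IntegrableOn (fun x =>
      (∏ j ∈ Finset.Icc 1 i, Xiter a j ‖x‖ ^ 2) / ‖x‖ ^ 2 * u x ^ 2) (Metric.ball 0 1) := by
    intro i hi
    have hX := ContBddUnit.XProd fun s hs => (hk s hs).mono (Finset.mem_Icc.1 hi).2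
    refine ((hX.mul hX).integrableOn_ball_div_sq_mul hn hsq hsqc).congr_fun (fun x _ => ?_)
      measurableSet_ball
    simp only [Finset.prod_pow, XProd]
    ring
  have e1 : ∫ x in Metric.ball 0 1, hardyWeight a k ν ‖x‖ / ‖x‖ ^ 2 * u x ^ 2 =
      ((ν : ℝ) / 2) ^ 2 * (∫ x in Metric.ball 0 1, u x ^ 2 / ‖x‖ ^ 2) +
        1 / 4 * ∑ i ∈ Finset.Icc 1 k, ∫ x in Metric.ball 0 1,
          (∏ j ∈ Finset.Icc 1 i, Xiter a j ‖x‖ ^ 2) / ‖x‖ ^ 2 * u x ^ 2 := by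
    rw [← integral_finsetSum _ i1, ← integral_const_mul, ← integral_const_mul,
      ← integral_add (i0.const_mul _) ((integrable_finsetSum _ i1).const_mul _)]
    refine integral_congr_ae (Filter.Eventually.of_forall fun x => ?_)
    simp only [hardyWeight, XProd, Finset.prod_pow, ← Finset.sum_mul, ← Finset.sum_div]
    ring
  rw [integral_sub (integrableOn_norm_gradient_sq hu1) (integrableOn_hardy hn hk hu1 hcs), e1]
    at hmain
  simp only [XProd] at hmain
  linarith
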